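/- arXiv:1704.05089 — 2 statements merged into one kernel-verified Lean document; each statement's English description precedes it below -/
import Mathlib

section
/- For every real ε > 0 there exists n₀ such that for every integer n ≥ n₀ there is a finite set S of exactly n points in ℝ² with no four points of S on a common line, such that every subset T ⊆ S with no three points of T on a common line satisfies |T| ≤ n^{5/6+ε}. -/
namespace GenPos

set_option linter.unusedSectionVars false

section Part
variable {α : Type*} [DecidableEq α]

open Classical in
/-- Weighted count of the subsets of `A` with property `Q`. -/
noncomputable def partZ (lam : ℝ) (Q : Finset α → Prop) (A : Finset α) : ℝ :=
  ∑ I ∈ A.powerset.filter Q, lam ^ I.card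

lemma partZ_nonneg {lam : ℝ} (hl : 0 ≤ lam) (Q : Finset α → Prop) (A : Finset α) :
    0 ≤ partZ lam Q A := Finset.sum_nonneg fun _ _ => pow_nonneg hl _

lemma partZ_mono {lam : ℝ} (hl : 0 ≤ lam) {Q Q' : Finset α → Prop} {A B : Finset α}
    (h : ∀ I ⊆ A, Q I → I ⊆ B ∧ Q' I) : partZ lam Q A ≤ partZ lam Q' B := by
  classical
  unfold partZ
  apply Finset.sum_le_sum_of_subset_of_nonneg
  · intro I hI
    simp only [Finset.mem_filter, Finset.mem_powerset] at hI ⊢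
    exact h I hI.1 hI.2
  · intros; positivity

lemma partZ_branch (lam : ℝ) (Q : Finset α → Prop) {A : Finset α} {v : α} (hv : v ∈ A) :
    partZ lam Q A = partZ lam Q (A.erase v) +
      lam * partZ lam (fun J => Q (insert v J)) (A.erase v) := by
  classical
  unfold partZ
  conv_lhs => rw [← Finset.insert_erase hv]
  simp only [Finset.sum_filter]
  rw [Finset.sum_powerset_insert (Finset.notMem_erase v A)]
  congr 1
  rw [Finset.mul_sum]
  apply Finset.sum_congr rfl
  intro J hJ
  have : v ∉ J := fun h => Finset.notMem_erase v A (Finset.mem_powerset.1 hJ h)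
  rw [Finset.card_insert_of_notMem this]
  split_ifs <;> ring

lemma partZ_le {lam : ℝ} (hl : 0 ≤ lam) (Q : Finset α → Prop) (A : Finset α) :
    partZ lam Q A ≤ Real.exp (lam * A.card) := by
  classical
  have h1 : partZ lam Q A ≤ (1 + lam) ^ A.card := by
    rw [add_comm, ← Finset.sum_pow_mul_eq_add_pow lam 1 A]
    simp only [one_pow, mul_one]
    exact Finset.sum_le_sum_of_subset_of_nonneg (Finset.filter_subset _ _)
      (by intros; positivity)
  refine h1.trans ?_
  rw [mul_comm, Real.exp_nat_mul]
  gcongr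
  rw [add_comm]; exact Real.add_one_le_exp lam

/-- Averaging: some vertex has large degree. -/
lemma exists_deg {A : Finset α} {K : Finset (Finset α)} {r : ℕ} (hK : ∀ e ∈ K, e ⊆ A ∧ e.card = r)
    (hA : A.Nonempty) :
    ∃ v ∈ A, r * K.card ≤ A.card * (K.filter (v ∈ ·)).card := by
  obtain ⟨v, hv, hmax⟩ := A.exists_max_image (fun v => (K.filter (v ∈ ·)).card) hA
  refine ⟨v, hv, ?_⟩
  have := Finset.sum_card_inter_le (s := A) (B := K) hmax
  rw [Finset.sum_congr rfl (g := fun _ => r)] at this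
  · simpa [mul_comm] using this
  · intro e he
    rw [Finset.inter_eq_right.2 (hK e he).1, (hK e he).2]

lemma card_hit {B : Finset α} {K : Finset (Finset α)} {D : ℕ}
    (hD : ∀ v, (K.filter (v ∈ ·)).card ≤ D) :
    (K.filter (fun e => ¬ Disjoint B e)).card ≤ B.card * D := by
  refine le_trans ?_ (Finset.sum_card_inter_le (s := B)
    (B := K.filter (fun e => ¬ Disjoint B e)) (n := D) ?_)
  · rw [Finset.card_eq_sum_ones]
    apply Finset.sum_le_sum
    intro e he
    have := (Finset.mem_filter.1 he).2
    rw [Finset.disjoint_iff_inter_eq_empty] at this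
    exact Finset.card_pos.2 (Finset.nonempty_iff_ne_empty.2 this)
  · intro v _
    refine le_trans (Finset.card_le_card ?_) (hD v)
    intro e; simp only [Finset.mem_filter]; tauto

/-- Kleitman-Winston phase. -/
lemma phase_two {lam μ L Z0 : ℝ} (hl : 0 ≤ lam) (hμ0 : 0 ≤ μ)
    {Good : Finset α → Prop} (hGood : ∀ I J, I ⊆ J → Good J → Good I)
    {V : Finset α} {G : Finset (Finset α)} {Δ : ℕ}
    (hG : ∀ e ∈ G, e ⊆ V ∧ e.card = 2) (hdeg : ∀ v, (G.filter (v ∈ ·)).card ≤ Δ)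
    (hbig : V.card * Δ ≤ 32 * G.card)
    (hμ : Real.exp (-μ) + lam * Real.exp (-L) ≤ 1) (hμL : 32 * L ≤ μ * Δ)
    (hZ0 : 0 ≤ Z0)
    (hsmall : ∀ B ⊆ V, 64 * B.card ≤ 63 * V.card → partZ lam Good B ≤ Z0) :
    ∀ A ⊆ V, partZ lam (fun I => Good I ∧ ∀ e ∈ G, ¬ e ⊆ I) A ≤ Z0 * Real.exp (μ * A.card) := by
  intro A
  induction A using Finset.strongInduction with
  | H A ih =>
  intro hAV
  by_cases hA : 64 * A.card ≤ 63 * V.card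
  · calc _ ≤ partZ lam Good A := partZ_mono hl (fun I hI h => ⟨hI, h.1⟩)
      _ ≤ Z0 := hsmall A hAV hA
      _ ≤ _ := le_mul_of_one_le_right hZ0 (Real.one_le_exp (by positivity))
  push Not at hA
  have hAne : A.Nonempty := by
    rw [← Finset.card_pos]; omega
  set K := G.filter (· ⊆ A) with hKdef
  obtain ⟨v, hv, hvd⟩ := exists_deg (A := A) (K := K) (r := 2)
    (fun e he => by rw [hKdef, Finset.mem_filter] at he; exact ⟨he.2, (hG e he.1).2⟩) hAne
  -- many edges inside A
  have hK1 : G.card ≤ K.card + (V \ A).card * Δ := by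
    rw [← Finset.card_filter_add_card_filter_not (s := G) (· ⊆ A)]
    gcongr
    refine le_trans (Finset.card_le_card ?_) (card_hit hdeg)
    intro e he
    rw [Finset.mem_filter] at he ⊢
    refine ⟨he.1, fun hd => he.2 ?_⟩
    intro x hx
    by_contra hxA
    exact Finset.disjoint_left.1 hd (Finset.mem_sdiff.2 ⟨(hG e he.1).1 hx, hxA⟩) hx
  have hVA : (V \ A).card + A.card = V.card := Finset.card_sdiff_add_card_eq_card hAV
  have hAle : A.card ≤ V.card := Finset.card_le_card hAV
  set dg := (K.filter (v ∈ ·)).card with hdg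
  have hdgΔ : Δ ≤ 32 * dg := by
    have h1 : 64 * ((V \ A).card * Δ) ≤ V.card * Δ := by
      rw [← mul_assoc]; gcongr; omega
    have h2 : A.card * dg ≤ V.card * dg := by gcongr
    have h3 : V.card * Δ ≤ V.card * (32 * dg) := by nlinarith
    exact Nat.le_of_mul_le_mul_left h3 (by omega)
  set Nb := (A.erase v).filter (fun y => ({v, y} : Finset α) ∈ G) with hNb
  have hNbc : dg ≤ Nb.card := by
    have : K.filter (v ∈ ·) ⊆ Nb.image (fun y => ({v, y} : Finset α)) := by
      intro e he
      simp only [hKdef, Finset.mem_filter] at he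
      obtain ⟨⟨heG, heA⟩, hve⟩ := he
      obtain ⟨x, y, hxy, rfl⟩ := Finset.card_eq_two.1 (hG e heG).2
      simp only [Finset.mem_insert, Finset.mem_singleton] at hve
      rw [Finset.mem_image]
      rcases hve with rfl | rfl
      · exact ⟨y, by simp [hNb, heG, hxy.symm]; exact heA (by simp), rfl⟩
      · exact ⟨x, by simp [hNb, Finset.pair_comm v x, heG, hxy]; exact heA (by simp),
          Finset.pair_comm _ _⟩
    exact (Finset.card_le_card this).trans Finset.card_image_le
  have hc1 : (A.erase v).card + 1 = A.card := Finset.card_erase_add_one hv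
  have b1 := ih (A.erase v) (Finset.erase_ssubset hv) ((Finset.erase_subset _ _).trans hAV)
  have hsub : (A.erase v) \ Nb ⊂ A :=
    (Finset.sdiff_subset).trans_ssubset (Finset.erase_ssubset hv)
  have b2 := ih ((A.erase v) \ Nb) hsub (hsub.1.trans hAV)
  have hc2 : ((A.erase v) \ Nb).card + Nb.card = (A.erase v).card :=
    Finset.card_sdiff_add_card_eq_card (Finset.filter_subset _ _)
  rw [partZ_branch lam _ hv]
  have b3 : partZ lam (fun J => (fun I => Good I ∧ ∀ e ∈ G, ¬ e ⊆ I) (insert v J)) (A.erase v)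
      ≤ partZ lam (fun I => Good I ∧ ∀ e ∈ G, ¬ e ⊆ I) ((A.erase v) \ Nb) := by
    apply partZ_mono hl
    rintro J hJ ⟨hg, he⟩
    refine ⟨?_, hGood _ _ (Finset.subset_insert _ _) hg, fun e heG hej =>
      he e heG (hej.trans (Finset.subset_insert _ _))⟩
    intro y hy
    refine Finset.mem_sdiff.2 ⟨hJ hy, fun hyN => ?_⟩
    refine he _ (Finset.mem_filter.1 hyN).2 ?_
    intro z hz
    simp only [Finset.mem_insert, Finset.mem_singleton] at hz ⊢
    rcases hz with rfl | rfl
    · exact Or.inl rfl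
    · exact Or.inr hy
  have e1 : ((A.erase v).card : ℝ) = A.card - 1 := by rw [← hc1]; push_cast; ring
  have e2 : μ * (((A.erase v) \ Nb).card : ℝ) ≤ μ * A.card - L := by
    have h1 : (((A.erase v) \ Nb).card : ℝ) ≤ A.card - dg := by
      have : ((A.erase v) \ Nb).card + dg ≤ A.card := by omega
      have : (((A.erase v) \ Nb).card : ℝ) + dg ≤ A.card := by exact_mod_cast this
      linarith
    have h2 : (Δ : ℝ) ≤ 32 * dg := by exact_mod_cast hdgΔ
    nlinarith
  calc _ ≤ Z0 * Real.exp (μ * (A.erase v).card) + lam * (Z0 * Real.exp (μ * A.card - L)) := by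
        gcongr
        exact b3.trans (b2.trans (by gcongr))
    _ = Z0 * Real.exp (μ * A.card) * (Real.exp (-μ) + lam * Real.exp (-L)) := by
        rw [e1, show μ * ((A.card : ℝ) - 1) = μ * A.card + -μ by ring, Real.exp_add,
          sub_eq_add_neg, Real.exp_add]; ring
    _ ≤ Z0 * Real.exp (μ * A.card) * 1 := by gcongr
    _ = _ := mul_one _

/-- Link-building phase. -/
lemma phase_one {lam μ ν L Z0 : ℝ} (hl : 0 ≤ lam) (hμ0 : 0 ≤ μ) (hν0 : 0 ≤ ν)
    {Good : Finset α → Prop} (hGood : ∀ I J, I ⊆ J → Good J → Good I)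
    {V : Finset α} {H : Finset (Finset α)} {D Δ : ℕ}
    (hH : ∀ e ∈ H, e ⊆ V ∧ e.card = 3) (hHdeg : ∀ v, (H.filter (v ∈ ·)).card ≤ D)
    (hlin : ∀ e ∈ H, ∀ f ∈ H, ∀ x y, x ≠ y → x ∈ e → y ∈ e → x ∈ f → y ∈ f → e = f)
    (hHG : ∀ e ∈ H, ¬ Good e)
    (hbig : V.card * D ≤ 8 * H.card)
    (hμ : Real.exp (-μ) + lam * Real.exp (-L) ≤ 1) (hμL : 32 * L ≤ μ * Δ) (hνL : 32 * L ≤ ν * D)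
    (hZ0 : 0 ≤ Z0)
    (hsmall : ∀ B ⊆ V, 64 * B.card ≤ 63 * V.card → partZ lam Good B ≤ Z0) :
    ∀ A ⊆ V, ∀ G : Finset (Finset α),
      (∀ e ∈ G, e ⊆ V ∧ e.card = 2) → (∀ v, (G.filter (v ∈ ·)).card ≤ Δ) →
      (∀ g ∈ G, ∃ f ∈ H, g ⊆ f ∧ ∃ x ∈ f, x ∉ A) →
      partZ lam (fun I => Good I ∧ ∀ e ∈ G, ¬ e ⊆ I) A ≤
        Z0 * Real.exp (μ * V.card) * Real.exp (μ * A.card + ν * (V.card * Δ - G.card)) := by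
  intro A
  induction A using Finset.strongInduction with
  | H A ih =>
  intro hAV G hG hdeg hfresh
  have hGle : (G.card : ℝ) ≤ V.card * Δ := by
    have := Finset.sum_card_inter_le (s := V) (B := G) (n := Δ) (fun v _ => hdeg v)
    rw [Finset.sum_congr rfl (g := fun _ => 2)
      (fun e he => by rw [Finset.inter_eq_right.2 (hG e he).1, (hG e he).2])] at this
    simp only [Finset.sum_const, smul_eq_mul] at this
    have : G.card ≤ V.card * Δ := by omega
    exact_mod_cast this
  have hexp1 : 1 ≤ Real.exp (μ * A.card + ν * (V.card * Δ - G.card)) := by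
    apply Real.one_le_exp
    have : 0 ≤ (V.card : ℝ) * Δ - G.card := by linarith
    positivity
  by_cases hA : 64 * A.card ≤ 63 * V.card
  · calc _ ≤ partZ lam Good A := partZ_mono hl (fun I hI h => ⟨hI, h.1⟩)
      _ ≤ Z0 := hsmall A hAV hA
      _ ≤ Z0 * Real.exp (μ * V.card) :=
        le_mul_of_one_le_right hZ0 (Real.one_le_exp (by positivity))
      _ ≤ _ := le_mul_of_one_le_right (by positivity) hexp1
  push Not at hA
  have hAne : A.Nonempty := by
    rw [← Finset.card_pos]; omega
  have hAle : A.card ≤ V.card := Finset.card_le_card hAV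
  set S := V.filter (fun y => Δ ≤ (G.filter (y ∈ ·)).card) with hS
  by_cases hSc : V.card ≤ 16 * S.card
  · -- many saturated vertices
    have hGbig : V.card * Δ ≤ 32 * G.card := by
      have h1 := Finset.le_sum_card_inter (s := S) (B := G) (n := Δ)
        (fun v hv => (Finset.mem_filter.1 hv).2)
      have h2 : ∑ e ∈ G, (S ∩ e).card ≤ ∑ e ∈ G, 2 := Finset.sum_le_sum fun e he => by
        rw [← (hG e he).2]; exact Finset.card_le_card Finset.inter_subset_right
      simp only [Finset.sum_const, smul_eq_mul] at h2
      have h3 : V.card * Δ ≤ 16 * S.card * Δ := by gcongr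
      nlinarith
    calc _ ≤ Z0 * Real.exp (μ * A.card) :=
          phase_two hl hμ0 hGood hG hdeg hGbig hμ hμL hZ0 hsmall A hAV
      _ ≤ Z0 * Real.exp (μ * V.card) := by gcongr
      _ ≤ _ := le_mul_of_one_le_right (by positivity) hexp1
  push Not at hSc
  set K := H.filter (fun e => e ⊆ A ∧ Disjoint S e) with hKdef
  obtain ⟨v, hv, hvd⟩ := exists_deg (A := A) (K := K) (r := 3)
    (fun e he => by rw [hKdef, Finset.mem_filter] at he; exact ⟨he.2.1, (hH e he.1).2⟩) hAne
  have hK1 : H.card ≤ K.card + ((V \ A) ∪ S).card * D := by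
    rw [← Finset.card_filter_add_card_filter_not (s := H) (fun e => e ⊆ A ∧ Disjoint S e)]
    gcongr
    refine le_trans (Finset.card_le_card ?_) (card_hit hHdeg)
    intro e he
    rw [Finset.mem_filter] at he ⊢
    refine ⟨he.1, fun hd => he.2 ?_⟩
    rw [Finset.disjoint_union_left] at hd
    refine ⟨?_, hd.2⟩
    intro x hx
    by_contra hxA
    exact Finset.disjoint_left.1 hd.1 (Finset.mem_sdiff.2 ⟨(hH e he.1).1 hx, hxA⟩) hx
  have hVA : (V \ A).card + A.card = V.card := Finset.card_sdiff_add_card_eq_card hAV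
  have hun := Finset.card_union_le (V \ A) S
  set dg := (K.filter (v ∈ ·)).card with hdg
  have hdgD : D ≤ 32 * dg := by
    have h1 : 64 * (((V \ A) ∪ S).card * D) ≤ 5 * V.card * D := by
      rw [← mul_assoc]; exact Nat.mul_le_mul_right _ (by omega)
    have h2 : A.card * dg ≤ V.card * dg := by gcongr
    have h3 : V.card * D ≤ V.card * (32 * dg) := by nlinarith
    exact Nat.le_of_mul_le_mul_left h3 (by omega)
  set G2 := (K.filter (v ∈ ·)).image (fun e => e.erase v) with hG2
  have hG2mem : ∀ g ∈ G2, ∃ e ∈ H, e ⊆ A ∧ Disjoint S e ∧ v ∈ e ∧ e.erase v = g := by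
    intro g hg
    simp only [hG2, hKdef, Finset.mem_image, Finset.mem_filter] at hg
    obtain ⟨e, ⟨⟨h1, h2, h3⟩, h4⟩, h5⟩ := hg
    exact ⟨e, h1, h2, h3, h4, h5⟩
  have hG2card : G2.card = dg := by
    apply Finset.card_image_of_injOn
    intro e he f hf hef
    have he := (Finset.mem_filter.1 he).2
    have hf := (Finset.mem_filter.1 hf).2
    dsimp only at hef
    rw [← Finset.insert_erase he, ← Finset.insert_erase hf, hef]
  have hG2G : Disjoint G G2 := by
    rw [Finset.disjoint_left]
    intro g hg hg2
    obtain ⟨e, heH, heA, heS, hve, rfl⟩ := hG2mem g hg2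
    obtain ⟨f, hfH, hgf, x, hxf, hxA⟩ := hfresh _ hg
    obtain ⟨a, b, hab, hcard⟩ := Finset.card_eq_two.1 (hG _ hg).2
    have ha : a ∈ e.erase v := by rw [hcard]; simp
    have hb : b ∈ e.erase v := by rw [hcard]; simp
    have := hlin e heH f hfH a b hab (Finset.mem_of_mem_erase ha) (Finset.mem_of_mem_erase hb)
      (hgf ha) (hgf hb)
    subst this
    exact hxA (heA hxf)
  have b1 := ih (A.erase v) (Finset.erase_ssubset hv) ((Finset.erase_subset _ _).trans hAV)
    G hG hdeg (fun g hg => by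
      obtain ⟨f, h1, h2, x, h3, h4⟩ := hfresh g hg
      exact ⟨f, h1, h2, x, h3, fun h => h4 (Finset.mem_of_mem_erase h)⟩)
  have b2 := ih (A.erase v) (Finset.erase_ssubset hv) ((Finset.erase_subset _ _).trans hAV)
    (G ∪ G2) (by
      intro g hg
      rcases Finset.mem_union.1 hg with hg | hg
      · exact hG g hg
      · obtain ⟨e, heH, heA, heS, hve, rfl⟩ := hG2mem g hg
        refine ⟨(Finset.erase_subset _ _).trans (hH e heH).1, ?_⟩
        rw [Finset.card_erase_of_mem hve, (hH e heH).2]) (by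
      intro y
      rw [Finset.filter_union]
      refine (Finset.card_union_le _ _).trans ?_
      by_cases hy : ∃ g ∈ G2, y ∈ g
      · obtain ⟨g, hg, hyg⟩ := hy
        have hone : (G2.filter (y ∈ ·)).card ≤ 1 := by
          rw [Finset.card_le_one]
          intro g1 hg1 g2 hg2
          rw [Finset.mem_filter] at hg1 hg2
          obtain ⟨e1, he1, -, -, hv1, rfl⟩ := hG2mem _ hg1.1
          obtain ⟨e2, he2, -, -, hv2, rfl⟩ := hG2mem _ hg2.1
          rw [hlin e1 he1 e2 he2 v y (Finset.ne_of_mem_erase hg1.2).symm hv1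
            (Finset.mem_of_mem_erase hg1.2) hv2 (Finset.mem_of_mem_erase hg2.2)]
        obtain ⟨e, heH, heA, heS, hve, rfl⟩ := hG2mem g hg
        have hye := Finset.mem_of_mem_erase hyg
        have hyS : y ∉ S := fun h => Finset.disjoint_left.1 heS h hye
        have : ¬ Δ ≤ (G.filter (y ∈ ·)).card := fun h =>
          hyS (Finset.mem_filter.2 ⟨(hH e heH).1 hye, h⟩)
        omega
      · have : G2.filter (y ∈ ·) = ∅ := by
          rw [Finset.filter_eq_empty_iff]
          intro g hg hyg; exact hy ⟨g, hg, hyg⟩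
        rw [this]; simpa using hdeg y) (by
      intro g hg
      rcases Finset.mem_union.1 hg with hg | hg
      · obtain ⟨f, h1, h2, x, h3, h4⟩ := hfresh g hg
        exact ⟨f, h1, h2, x, h3, fun h => h4 (Finset.mem_of_mem_erase h)⟩
      · obtain ⟨e, heH, heA, heS, hve, rfl⟩ := hG2mem g hg
        exact ⟨e, heH, Finset.erase_subset _ _, v, hve, Finset.notMem_erase _ _⟩)
  have hc1 : (A.erase v).card + 1 = A.card := Finset.card_erase_add_one hv
  rw [partZ_branch lam _ hv]
  have b3 : partZ lam (fun J => (fun I => Good I ∧ ∀ e ∈ G, ¬ e ⊆ I) (insert v J)) (A.erase v)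
      ≤ partZ lam (fun I => Good I ∧ ∀ e ∈ G ∪ G2, ¬ e ⊆ I) (A.erase v) := by
    apply partZ_mono hl
    rintro J hJ ⟨hg, he⟩
    refine ⟨hJ, hGood _ _ (Finset.subset_insert _ _) hg, fun e heG hej => ?_⟩
    rcases Finset.mem_union.1 heG with hgG | hgG
    · exact he e hgG (hej.trans (Finset.subset_insert _ _))
    · obtain ⟨f, hfH, -, -, hvf, rfl⟩ := hG2mem e hgG
      apply hHG f hfH
      refine hGood _ _ ?_ hg
      rw [← Finset.insert_erase hvf]
      exact Finset.insert_subset_insert _ hej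
  have e1 : ((A.erase v).card : ℝ) = A.card - 1 := by rw [← hc1]; push_cast; ring
  have e2 : ((G ∪ G2).card : ℝ) = G.card + dg := by
    rw [Finset.card_union_of_disjoint hG2G, hG2card]; push_cast; ring
  have e3 : L ≤ ν * dg := by
    have h2 : (D : ℝ) ≤ 32 * dg := by exact_mod_cast hdgD
    nlinarith
  rw [e1] at b1 b2
  rw [e2] at b2
  obtain ⟨P, hP⟩ : ∃ P, P = μ * A.card + ν * ((V.card : ℝ) * Δ - G.card) := ⟨_, rfl⟩
  rw [← hP]
  calc _ ≤ Z0 * Real.exp (μ * V.card) * Real.exp (P + -μ) +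
        lam * (Z0 * Real.exp (μ * V.card) * Real.exp (P + - L)) := by
        gcongr
        · exact b1.trans (le_of_eq (by rw [hP]; ring_nf))
        · refine b3.trans (b2.trans ?_)
          refine mul_le_mul_of_nonneg_left (Real.exp_le_exp.2 ?_) (by positivity)
          rw [hP]; nlinarith
    _ = Z0 * Real.exp (μ * V.card) * Real.exp P * (Real.exp (-μ) + lam * Real.exp (-L)) := by
        rw [Real.exp_add, Real.exp_add]; ring
    _ ≤ Z0 * Real.exp (μ * V.card) * Real.exp P * 1 := by gcongr
    _ = _ := mul_one _

lemma container_step {lam μ ν L Z0 : ℝ} (hl : 0 ≤ lam) (hμ0 : 0 ≤ μ) (hν0 : 0 ≤ ν)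
    {Good : Finset α → Prop} (hGood : ∀ I J, I ⊆ J → Good J → Good I)
    {V : Finset α} {H : Finset (Finset α)} {D Δ : ℕ}
    (hH : ∀ e ∈ H, e ⊆ V ∧ e.card = 3) (hHdeg : ∀ v, (H.filter (v ∈ ·)).card ≤ D)
    (hlin : ∀ e ∈ H, ∀ f ∈ H, ∀ x y, x ≠ y → x ∈ e → y ∈ e → x ∈ f → y ∈ f → e = f)
    (hHG : ∀ e ∈ H, ¬ Good e)
    (hbig : V.card * D ≤ 8 * H.card)
    (hμ : Real.exp (-μ) + lam * Real.exp (-L) ≤ 1) (hμL : 32 * L ≤ μ * Δ) (hνL : 32 * L ≤ ν * D)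
    (hZ0 : 0 ≤ Z0)
    (hsmall : ∀ B ⊆ V, 64 * B.card ≤ 63 * V.card → partZ lam Good B ≤ Z0) :
    partZ lam Good V ≤ Z0 * Real.exp (2 * μ * V.card + ν * V.card * Δ) := by
  have h := phase_one hl hμ0 hν0 hGood hH hHdeg hlin hHG hbig hμ hμL hνL hZ0 hsmall V
    subset_rfl ∅ (by simp) (by simp) (by simp)
  calc _ ≤ _ := partZ_mono hl (fun I hI hg => ⟨hI, hg, by simp⟩)
    _ ≤ _ := h
    _ = _ := by rw [mul_assoc, ← Real.exp_add]; congr 2; simp; ring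

/-- First-moment method, derandomised. -/
lemma exists_ge_expect {p : ℝ} (hp0 : 0 ≤ p) (hp1 : p ≤ 1) (V : Finset α) :
    ∀ c : Finset α → ℝ, ∃ R ⊆ V,
      ∑ B ∈ V.powerset, c B * p ^ B.card ≤ ∑ B ∈ R.powerset, c B := by
  induction V using Finset.induction_on with
  | empty => intro c; exact ⟨∅, subset_rfl, by simp⟩
  | insert a V ha ih =>
    intro c
    rw [Finset.sum_powerset_insert ha]
    obtain ⟨R1, hR1, h1⟩ := ih c
    obtain ⟨R2, hR2, h2⟩ := ih (fun B => c B + c (insert a B))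
    have key : ∑ B ∈ V.powerset, c (insert a B) * p ^ (insert a B).card =
        p * ∑ B ∈ V.powerset, c (insert a B) * p ^ B.card := by
      rw [Finset.mul_sum]
      apply Finset.sum_congr rfl
      intro B hB
      rw [Finset.card_insert_of_notMem (fun h => ha (Finset.mem_powerset.1 hB h))]
      ring
    simp only [add_mul, Finset.sum_add_distrib] at h2
    rw [key]
    by_cases hs : ∑ B ∈ V.powerset, c (insert a B) * p ^ B.card ≤ 0
    · refine ⟨R1, hR1.trans (Finset.subset_insert _ _), le_trans ?_ h1⟩
      nlinarith
    · push Not at hs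
      refine ⟨insert a R2, Finset.insert_subset_insert _ hR2, ?_⟩
      rw [Finset.sum_powerset_insert (fun h => ha (hR2 h))]
      refine le_trans ?_ h2
      nlinarith

end Part
end GenPos

namespace GenPos

section Geom

/-- Parallel integer vectors. -/
def Par (u v : Fin 3 → ℤ) : Prop := ∀ i j, u i * v j = u j * v i

/-- No three distinct collinear points. -/
def Good (T : Finset (Fin 3 → ℤ)) : Prop :=
  ∀ x ∈ T, ∀ y ∈ T, ∀ z ∈ T, x ≠ y → y ≠ z → x ≠ z → ¬ Par (y - x) (z - x)

lemma Good.anti (I J : Finset (Fin 3 → ℤ)) (h : I ⊆ J) (hJ : Good J) : Good I :=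
  fun x hx y hy z hz => hJ x (h hx) y (h hy) z (h hz)

/-- The cubic grid. -/
noncomputable def grid (m : ℕ) : Finset (Fin 3 → ℤ) := Fintype.piFinset fun _ => Finset.Ico 0 (m : ℤ)

lemma mem_grid {m : ℕ} {x : Fin 3 → ℤ} : x ∈ grid m ↔ ∀ i, 0 ≤ x i ∧ x i < m := by
  simp [grid, Fintype.mem_piFinset]

lemma card_grid (m : ℕ) : (grid m).card = m ^ 3 := by
  simp [grid, Fintype.card_piFinset]

/-- Positive vectors with entries at most `k`. -/
noncomputable def box (k : ℕ) : Finset (Fin 3 → ℤ) := Fintype.piFinset fun _ => Finset.Icc 1 (k : ℤ)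

lemma mem_box {k : ℕ} {x : Fin 3 → ℤ} : x ∈ box k ↔ ∀ i, 1 ≤ x i ∧ x i ≤ k := by
  simp [box, Fintype.mem_piFinset]

lemma card_box (k : ℕ) : (box k).card = k ^ 3 := by
  simp [box, Fintype.card_piFinset]

/-- Primitive directions. -/
noncomputable def dirs (k : ℕ) : Finset (Fin 3 → ℤ) := (box k).filter fun v => Finset.univ.gcd v = 1

lemma sum_inv_cube (k : ℕ) (hk : 1 ≤ k) :
    ∑ d ∈ Finset.Icc 2 k, (1 : ℝ) / d ^ 3 ≤ 1 / 4 - 1 / (2 * k * (k + 1)) := by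
  induction k, hk using Nat.le_induction with
  | base => norm_num
  | succ k hk ih =>
    rw [Finset.sum_Icc_succ_top (by omega)]
    have hk' : (0 : ℝ) < k := by exact_mod_cast hk
    have : (1 : ℝ) / (k + 1) ^ 3 ≤ 1 / (2 * k * (k + 1)) - 1 / (2 * (k + 1) * (k + 1 + 1)) := by
      rw [show (1 : ℝ) / (2 * k * (k + 1)) - 1 / (2 * (k + 1) * (k + 1 + 1)) =
        1 / (k * (k + 1) * (k + 2)) by field_simp; ring]
      apply one_div_le_one_div_of_le (by positivity)
      nlinarith
    push_cast
    linarith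

lemma card_dirs (k : ℕ) (hk : 1 ≤ k) : 3 * k ^ 3 ≤ 4 * (dirs k).card := by
  have h1 := Finset.card_filter_add_card_filter_not (s := box k) (fun v => Finset.univ.gcd v = 1)
  rw [card_box] at h1
  have h2 : (box k).filter (fun v => ¬ Finset.univ.gcd v = 1) ⊆
      (Finset.Icc 2 k).biUnion fun d => (box (k / d)).image fun v => (d : ℤ) • v := by
    intro v hv
    rw [Finset.mem_filter, mem_box] at hv
    obtain ⟨hb, hg⟩ := hv
    have hg0 : 0 ≤ Finset.univ.gcd v := by
      rw [← Finset.normalize_gcd]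
      exact Int.nonneg_of_normalize_eq_self (by simp)
    have hdv : ∀ i, Finset.univ.gcd v ∣ v i := fun i => Finset.gcd_dvd (Finset.mem_univ i)
    obtain ⟨d, hd⟩ := Int.eq_ofNat_of_zero_le hg0
    rw [hd] at hdv hg
    have hd0 : d ≠ 0 := by
      rintro rfl
      have := hdv 0
      have h3 := hb 0
      simp at this
      omega
    have hdk : d ≤ k := by
      have := Int.le_of_dvd (by have := hb 0; omega) (hdv 0)
      have := hb 0
      omega
    have hd1 : d ≠ 1 := by rintro rfl; simp at hg
    rw [Finset.mem_biUnion]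
    refine ⟨d, Finset.mem_Icc.2 ⟨by omega, hdk⟩, ?_⟩
    choose w hw using hdv
    rw [Finset.mem_image]
    refine ⟨w, mem_box.2 fun i => ?_, ?_⟩
    · have hbi := hb i
      rw [hw i] at hbi
      have hdp : (0 : ℤ) < d := by exact_mod_cast Nat.pos_of_ne_zero hd0
      refine ⟨?_, ?_⟩
      · by_contra hlt
        push Not at hlt
        have : (d : ℤ) * w i ≤ 0 := by nlinarith
        omega
      · push_cast
        rw [Int.le_ediv_iff_mul_le hdp]
        linarith
    · ext i; simp [hw i]
  have h3 : (((box k).filter (fun v => ¬ Finset.univ.gcd v = 1)).card : ℝ) ≤ (k : ℝ) ^ 3 / 4 := by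
    have h4 : ((box k).filter (fun v => ¬ Finset.univ.gcd v = 1)).card ≤
        ∑ d ∈ Finset.Icc 2 k, (k / d) ^ 3 := by
      refine (Finset.card_le_card h2).trans (Finset.card_biUnion_le.trans ?_)
      apply Finset.sum_le_sum
      intro d _
      rw [← card_box]
      exact Finset.card_image_le
    calc (((box k).filter (fun v => ¬ Finset.univ.gcd v = 1)).card : ℝ)
        ≤ ((∑ d ∈ Finset.Icc 2 k, (k / d) ^ 3 : ℕ) : ℝ) := by exact_mod_cast h4
      _ ≤ ∑ d ∈ Finset.Icc 2 k, (k : ℝ) ^ 3 * (1 / d ^ 3) := by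
          push_cast
          apply Finset.sum_le_sum
          intro d _
          have : ((k / d : ℕ) : ℝ) ≤ (k : ℝ) / d := Nat.cast_div_le
          calc ((k / d : ℕ) : ℝ) ^ 3 ≤ ((k : ℝ) / d) ^ 3 := by gcongr
            _ = _ := by rw [div_pow]; ring
      _ ≤ (k : ℝ) ^ 3 * (1 / 4) := by
          rw [← Finset.mul_sum]
          gcongr
          refine (sum_inv_cube k hk).trans ?_
          have : (0 : ℝ) ≤ 1 / (2 * k * (k + 1)) := by positivity
          linarith
      _ = _ := by ring
  have h5 : 4 * ((box k).filter (fun v => ¬ Finset.univ.gcd v = 1)).card ≤ k ^ 3 := by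
    have : (4 : ℝ) * ((box k).filter (fun v => ¬ Finset.univ.gcd v = 1)).card ≤ (k : ℝ) ^ 3 := by
      linarith
    exact_mod_cast this
  unfold dirs
  omega

lemma dirs_unique {k : ℕ} {u w : Fin 3 → ℤ} (hu : u ∈ dirs k) (hw : w ∈ dirs k) {s t : ℤ}
    (hs : s ≠ 0) (h : ∀ i, s * u i = t * w i) : u = w := by
  rw [dirs, Finset.mem_filter, mem_box] at hu hw
  have h1 : Finset.univ.gcd (fun i => s * u i) = Finset.univ.gcd (fun i => t * w i) := by
    congr 1; funext i; exact h i
  rw [Finset.gcd_mul_left, Finset.gcd_mul_left, hu.2, hw.2, mul_one, mul_one,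
    ← Int.abs_eq_normalize, ← Int.abs_eq_normalize] at h1
  rcases abs_eq_abs.1 h1 with rfl | rfl
  · funext i
    exact mul_left_cancel₀ hs (h i)
  · exfalso
    have h0 := h 0
    have := (hu.1 0).1
    have := (hw.1 0).1
    have h2 : t * (u 0 + w 0) = 0 := by linarith
    rcases mul_eq_zero.1 h2 with h3 | h3
    · simp [h3] at hs
    · omega

/-- Label of the line in direction `v` through `x`. -/
def lab (v x : Fin 3 → ℤ) : Fin 3 → ℤ :=
  x - (min (x 0 / v 0) (min (x 1 / v 1) (x 2 / v 2))) • v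

lemma lab_eq {v x y : Fin 3 → ℤ} (h : lab v x = lab v y) : ∃ s : ℤ, x - y = s • v := by
  unfold lab at h
  refine ⟨(min (x 0 / v 0) (min (x 1 / v 1) (x 2 / v 2))) -
    (min (y 0 / v 0) (min (y 1 / v 1) (y 2 / v 2))), ?_⟩
  rw [sub_smul, sub_eq_sub_iff_add_eq_add]
  rw [sub_eq_sub_iff_add_eq_add] at h
  rw [h]; abel

lemma card_lab {m k : ℕ} {v : Fin 3 → ℤ} (hv : v ∈ box k) {A : Finset (Fin 3 → ℤ)}
    (hA : A ⊆ grid m) : (A.image (lab v)).card ≤ 3 * k * m ^ 2 := by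
  rw [mem_box] at hv
  have hsub : A.image (lab v) ⊆ Finset.univ.biUnion fun i : Fin 3 =>
      Fintype.piFinset fun j => if j = i then Finset.Ico 0 (k : ℤ) else Finset.Ico 0 (m : ℤ) := by
    intro z hz
    rw [Finset.mem_image] at hz
    obtain ⟨x, hx, rfl⟩ := hz
    have hg := mem_grid.1 (hA hx)
    obtain ⟨j, hj⟩ : ∃ j, j = min (x 0 / v 0) (min (x 1 / v 1) (x 2 / v 2)) := ⟨_, rfl⟩
    have hle : ∀ i, j ≤ x i / v i := by
      intro i; fin_cases i <;> simp [hj]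
    have hj0 : 0 ≤ j := by
      rw [hj]
      have := fun i => Int.ediv_nonneg (hg i).1 (show 0 ≤ v i by have := hv i; omega)
      exact le_min (this 0) (le_min (this 1) (this 2))
    have hex : ∃ i, j = x i / v i := by
      rcases min_choice (x 0 / v 0) (min (x 1 / v 1) (x 2 / v 2)) with h | h
      · exact ⟨0, hj.trans h⟩
      · rcases min_choice (x 1 / v 1) (x 2 / v 2) with h' | h'
        · exact ⟨1, by rw [hj, h, h']⟩
        · exact ⟨2, by rw [hj, h, h']⟩
    obtain ⟨i, hi⟩ := hex
    rw [Finset.mem_biUnion]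
    refine ⟨i, Finset.mem_univ _, ?_⟩
    rw [Fintype.mem_piFinset]
    intro l
    have hval : lab v x l = x l - j * v l := by simp [lab, hj]
    have hvl : 0 < v l := by have := hv l; omega
    have h1 : j * v l ≤ x l := (Int.le_ediv_iff_mul_le hvl).1 (hle l)
    have h2 : 0 ≤ j * v l := by positivity
    have h3 := hg l
    rw [hval]
    split_ifs with hli
    · subst hli
      rw [Finset.mem_Ico]
      have h4 := Int.emod_add_mul_ediv (x l) (v l)
      have h5 := Int.emod_lt_of_pos (x l) hvl
      rw [← hi] at h4
      have h6 := (hv l).2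
      have h7 : v l * j = j * v l := mul_comm _ _
      constructor <;> linarith
    · rw [Finset.mem_Ico]; constructor <;> linarith
  refine (Finset.card_le_card hsub).trans (Finset.card_biUnion_le.trans ?_)
  rw [Fin.sum_univ_three]
  simp only [Fintype.card_piFinset, Fin.prod_univ_three]
  simp
  apply le_of_eq; ring

/-- Greedy choice of disjoint monochromatic triples. -/
lemma exists_triples {α β : Type*} [DecidableEq α] [DecidableEq β] (f : α → β) (l : ℕ) :
    ∀ A : Finset α, (A.image f).card ≤ l →
    ∃ T : Finset (Finset α), (∀ e ∈ T, e ⊆ A ∧ e.card = 3 ∧ ∀ x ∈ e, ∀ y ∈ e, f x = f y) ∧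
      (∀ e ∈ T, ∀ e' ∈ T, ∀ x, x ∈ e → x ∈ e' → e = e') ∧ A.card ≤ 3 * T.card + 2 * l := by
  intro A
  induction A using Finset.strongInduction with
  | H A ih =>
  intro hl
  by_cases hA : A.card ≤ 2 * l
  · exact ⟨∅, by simp, by simp, by simpa using hA⟩
  push Not at hA
  obtain ⟨y, hy, hfib⟩ := Finset.exists_lt_card_fiber_of_mul_lt_card_of_maps_to
    (s := A) (t := A.image f) (f := f) (n := 2)
    (fun a ha => Finset.mem_image_of_mem f ha) (by omega)
  obtain ⟨e, he, hec⟩ := Finset.exists_subset_card_eq (show 3 ≤ _ from hfib)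
  have heA : e ⊆ A := he.trans (Finset.filter_subset _ _)
  have hene : e.Nonempty := by rw [← Finset.card_pos]; omega
  obtain ⟨T, hT1, hT2, hT3⟩ := ih (A \ e) (Finset.sdiff_ssubset heA hene)
    ((Finset.card_le_card (Finset.image_subset_image Finset.sdiff_subset)).trans hl)
  have hdis : ∀ e' ∈ T, ∀ x, x ∈ e → x ∉ e' := by
    intro e' he' x hx hx'
    exact (Finset.mem_sdiff.1 ((hT1 e' he').1 hx')).2 hx
  have heT : e ∉ T := by
    intro h
    obtain ⟨x, hx⟩ := hene
    exact hdis e h x hx hx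
  refine ⟨insert e T, ?_, ?_, ?_⟩
  · intro e' he'
    rcases Finset.mem_insert.1 he' with rfl | he'
    · refine ⟨heA, hec, fun x hx z hz => ?_⟩
      rw [(Finset.mem_filter.1 (he hx)).2, (Finset.mem_filter.1 (he hz)).2]
    · exact ⟨(hT1 e' he').1.trans Finset.sdiff_subset, (hT1 e' he').2⟩
  · intro e1 h1 e2 h2 x hx1 hx2
    rcases Finset.mem_insert.1 h1 with h3 | h3 <;> rcases Finset.mem_insert.1 h2 with h4 | h4
    · rw [h3, h4]
    · rw [h3] at hx1
      exact absurd hx2 (hdis _ h4 x hx1)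
    · rw [h4] at hx2
      exact absurd hx1 (hdis _ h3 x hx2)
    · exact hT2 _ h3 _ h4 x hx1 hx2
  · rw [Finset.card_insert_of_notMem heT]
    have := Finset.card_sdiff_add_card_eq_card heA
    omega

lemma supersat {m k : ℕ} (hk : 1 ≤ k) {A : Finset (Fin 3 → ℤ)} (hA : A ⊆ grid m)
    (hc : 12 * k * m ^ 2 ≤ A.card) :
    ∃ H : Finset (Finset (Fin 3 → ℤ)), (∀ e ∈ H, e ⊆ A ∧ e.card = 3) ∧
      (∀ v, (H.filter (v ∈ ·)).card ≤ k ^ 3) ∧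
      (∀ e ∈ H, ∀ f ∈ H, ∀ x y, x ≠ y → x ∈ e → y ∈ e → x ∈ f → y ∈ f → e = f) ∧
      (∀ e ∈ H, ¬ Good e) ∧ A.card * k ^ 3 ≤ 8 * H.card := by
  have hall : ∀ v : Fin 3 → ℤ, ∃ T : Finset (Finset (Fin 3 → ℤ)), v ∈ dirs k →
      (∀ e ∈ T, e ⊆ A ∧ e.card = 3 ∧ ∀ x ∈ e, ∀ y ∈ e, lab v x = lab v y) ∧
      (∀ e ∈ T, ∀ e' ∈ T, ∀ x, x ∈ e → x ∈ e' → e = e') ∧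
      A.card ≤ 3 * T.card + 2 * (3 * k * m ^ 2) := by
    intro v
    by_cases hv : v ∈ dirs k
    · obtain ⟨T, hT⟩ := exists_triples (lab v) (3 * k * m ^ 2) A
        (card_lab (Finset.mem_filter.1 hv).1 hA)
      exact ⟨T, fun _ => hT⟩
    · exact ⟨∅, fun h => absurd h hv⟩
  choose T hT using hall
  have hdir : ∀ v ∈ dirs k, ∀ w ∈ dirs k, ∀ e ∈ T v, ∀ f ∈ T w, ∀ x y, x ≠ y → x ∈ e → y ∈ e →
      x ∈ f → y ∈ f → v = w := by
    intro v hv w hw e he f hf x y hxy hxe hye hxf hyf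
    obtain ⟨s, hs⟩ := lab_eq (((hT v hv).1 e he).2.2 x hxe y hye)
    obtain ⟨t, ht⟩ := lab_eq (((hT w hw).1 f hf).2.2 x hxf y hyf)
    have hs0 : s ≠ 0 := by
      rintro rfl
      rw [zero_smul, sub_eq_zero] at hs
      exact hxy hs
    refine dirs_unique hv hw hs0 (t := t) fun i => ?_
    have := congrFun (hs.symm.trans ht) i
    simpa using this
  refine ⟨(dirs k).biUnion T, ?_, ?_, ?_, ?_, ?_⟩
  · intro e he
    obtain ⟨v, hv, he⟩ := Finset.mem_biUnion.1 he
    exact ⟨((hT v hv).1 e he).1, ((hT v hv).1 e he).2.1⟩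
  · intro x
    rw [Finset.filter_biUnion]
    refine Finset.card_biUnion_le.trans ?_
    calc _ ≤ ∑ v ∈ dirs k, 1 := by
          apply Finset.sum_le_sum
          intro v hv
          rw [Finset.card_le_one]
          intro a ha b hb
          rw [Finset.mem_filter] at ha hb
          exact (hT v hv).2.1 a ha.1 b hb.1 x ha.2 hb.2
      _ = (dirs k).card := by simp
      _ ≤ (box k).card := Finset.card_filter_le _ _
      _ = k ^ 3 := card_box k
  · intro e he f hf x y hxy hxe hye hxf hyf
    obtain ⟨v, hv, he⟩ := Finset.mem_biUnion.1 he
    obtain ⟨w, hw, hf⟩ := Finset.mem_biUnion.1 hf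
    have := hdir v hv w hw e he f hf x y hxy hxe hye hxf hyf
    subst this
    exact (hT v hv).2.1 e he f hf x hxe hxf
  · intro e he hgood
    obtain ⟨v, hv, he⟩ := Finset.mem_biUnion.1 he
    obtain ⟨hsub, hcard, hlab⟩ := (hT v hv).1 e he
    obtain ⟨x, y, z, hxy, hxz, hyz, rfl⟩ := Finset.card_eq_three.1 hcard
    refine hgood x (by simp) y (by simp) z (by simp) hxy hyz hxz ?_
    obtain ⟨s, hs⟩ := lab_eq (hlab y (by simp) x (by simp))
    obtain ⟨t, ht⟩ := lab_eq (hlab z (by simp) x (by simp))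
    intro i j
    rw [hs, ht]
    simp; ring
  · have hdisj : ((dirs k : Finset _) : Set (Fin 3 → ℤ)).PairwiseDisjoint T := by
      intro v hv w hw hvw
      rw [Function.onFun, Finset.disjoint_left]
      intro e he hf
      apply hvw
      obtain ⟨hsub, hcard, hlab⟩ := (hT v hv).1 e he
      obtain ⟨x, y, z, hxy, hxz, hyz, rfl⟩ := Finset.card_eq_three.1 hcard
      exact hdir v hv w hw _ he _ hf x y hxy (by simp) (by simp) (by simp) (by simp)
    rw [Finset.card_biUnion hdisj]
    have h1 : (dirs k).card * A.card ≤ 6 * ∑ v ∈ dirs k, (T v).card := by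
      rw [Finset.mul_sum, ← smul_eq_mul, ← Finset.sum_const]
      apply Finset.sum_le_sum
      intro v hv
      have := (hT v hv).2.2
      have h3 : 12 * k * m ^ 2 = 12 * (k * m ^ 2) := by ring
      have h4 : 2 * (3 * k * m ^ 2) = 6 * (k * m ^ 2) := by ring
      omega
    have h2 := card_dirs k hk
    nlinarith

/-- All triples from `Q` are collinear. -/
def ColSet (Q : Finset (Fin 3 → ℤ)) : Prop :=
  ∀ x ∈ Q, ∀ y ∈ Q, ∀ z ∈ Q, Par (y - x) (z - x)

/-- Vectors with bounded entries. -/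
noncomputable def cube (r : ℕ) : Finset (Fin 3 → ℤ) := Fintype.piFinset fun _ => Finset.Icc (-(r : ℤ)) r

lemma card_cube (r : ℕ) : (cube r).card = (2 * r + 1) ^ 3 := by
  simp [cube, Fintype.card_piFinset]
  omega

lemma quad_param {m : ℕ} {Q : Finset (Fin 3 → ℤ)} (hQ : Q ⊆ grid m) (hc : Q.card = 4)
    (hcol : ColSet Q) : ∃ g ∈ Finset.Icc 1 m, ∃ x ∈ grid m, ∃ d ∈ cube (m / g),
      ∃ i ∈ Finset.range (g + 1), ∃ j ∈ Finset.range (g + 1),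
      Q = {x, x + (g : ℤ) • d, x + (i : ℤ) • d, x + (j : ℤ) • d} := by
  obtain ⟨a, ha, b, hb, hab⟩ := Finset.one_lt_card.1 (show 1 < Q.card by omega)
  obtain ⟨c, hcc⟩ : ∃ c, a c ≠ b c := by
    by_contra h; push Not at h; exact hab (funext h)
  obtain ⟨x, hx, hxmin⟩ := Q.exists_min_image (fun z => z c) ⟨a, ha⟩
  obtain ⟨y, hy, hymax⟩ := Q.exists_max_image (fun z => z c) ⟨a, ha⟩
  have hxyc : x c < y c := by
    have h1 := hxmin a ha
    have h2 := hxmin b hb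
    have h3 := hymax a ha
    have h4 := hymax b hb
    omega
  have hxy : x ≠ y := by rintro rfl; omega
  obtain ⟨d, hd, hdg⟩ := Finset.extract_gcd (s := Finset.univ) (fun i => y i - x i)
    Finset.univ_nonempty
  set gz := Finset.univ.gcd (fun i => y i - x i) with hgz
  have hg0 : 0 ≤ gz := by
    rw [hgz, ← Finset.normalize_gcd]
    exact Int.nonneg_of_normalize_eq_self (by simp)
  clear_value gz
  obtain ⟨g, rfl⟩ := Int.eq_ofNat_of_zero_le hg0
  have hd' : ∀ i, y i - x i = g * d i := fun i => hd i (Finset.mem_univ i)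
  have hgpos : 0 < g := by
    rcases Nat.eq_zero_or_pos g with rfl | h
    · have := hd' c; simp at this; omega
    · exact h
  have hgz' : (0 : ℤ) < g := by exact_mod_cast hgpos
  have hdc : 0 < d c := by
    have := hd' c
    by_contra h
    push Not at h
    nlinarith
  have hpt : ∀ z ∈ Q, ∃ i ∈ Finset.range (g + 1), z = x + (i : ℤ) • d := by
    intro z hz
    have hp : ∀ e, d c * (z e - x e) = (z c - x c) * d e := by
      intro e
      have := hcol x hx y hy z hz c e
      simp only [Pi.sub_apply, hd'] at this
      apply mul_left_cancel₀ hgz'.ne'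
      linarith
    have hdvd : d c ∣ z c - x c := by
      have h1 : d c ∣ Finset.univ.gcd (fun e => (z c - x c) * d e) := by
        apply Finset.dvd_gcd
        intro e _
        exact ⟨_, (hp e).symm⟩
      rw [Finset.gcd_mul_left, hdg, mul_one] at h1
      exact (dvd_normalize_iff).1 h1
    obtain ⟨i, hi⟩ := hdvd
    have h1 := hxmin z hz
    have h2 := hymax z hz
    have h3 := hd' c
    have hi0 : 0 ≤ i := by
      by_contra h; push Not at h; nlinarith
    have hig : i ≤ g := by
      by_contra h; push Not at h; nlinarith
    obtain ⟨i, rfl⟩ := Int.eq_ofNat_of_zero_le hi0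
    refine ⟨i, by simp; omega, ?_⟩
    funext e
    have := hp e
    rw [hi] at this
    have h5 : d c * (z e - x e) = d c * (i * d e) := by linarith
    have h6 := mul_left_cancel₀ hdc.ne' h5
    simp; linarith
  have hrest : ((Q.erase x).erase y).card = 2 := by
    rw [Finset.card_erase_of_mem (Finset.mem_erase.2 ⟨hxy.symm, hy⟩), Finset.card_erase_of_mem hx, hc]
  obtain ⟨z, u, hzu, hzuq⟩ := Finset.card_eq_two.1 hrest
  have hzQ : z ∈ Q := by
    have : z ∈ (Q.erase x).erase y := by rw [hzuq]; simp
    exact Finset.mem_of_mem_erase (Finset.mem_of_mem_erase this)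
  have huQ : u ∈ Q := by
    have : u ∈ (Q.erase x).erase y := by rw [hzuq]; simp
    exact Finset.mem_of_mem_erase (Finset.mem_of_mem_erase this)
  obtain ⟨i, hi, hzi⟩ := hpt z hzQ
  obtain ⟨j, hj, huj⟩ := hpt u huQ
  have hyx : y = x + (g : ℤ) • d := by
    funext e; have := hd' e; simp; linarith
  have hgd : ∀ e, |(g : ℤ) * d e| < m := by
    intro e
    rw [← hd' e, abs_lt]
    have h1 := mem_grid.1 (hQ hx) e
    have h2 := mem_grid.1 (hQ hy) e
    constructor <;> linarith
  have hgm : g ≤ m := by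
    have := hgd c
    rw [abs_of_pos (by positivity)] at this
    have : (g : ℤ) ≤ m := by nlinarith
    exact_mod_cast this
  refine ⟨g, Finset.mem_Icc.2 ⟨hgpos, hgm⟩, x, hQ hx, d, ?_, i, hi, j, hj, ?_⟩
  · rw [cube, Fintype.mem_piFinset]
    intro e
    rw [Finset.mem_Icc, ← abs_le]
    push_cast
    rw [Int.le_ediv_iff_mul_le hgz']
    have := hgd e
    rw [abs_mul, abs_of_pos hgz'] at this
    linarith
  · rw [← hyx, ← hzi, ← huj, ← hzuq, Finset.insert_erase (Finset.mem_erase.2 ⟨hxy.symm, hy⟩),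
      Finset.insert_erase hx]

open Classical in
lemma card_quads {m : ℕ} (hm : 1 ≤ m) :
    (((grid m).powerset.filter (fun Q => Q.card = 4 ∧ ColSet Q)).card : ℝ) ≤
      108 * (m : ℝ) ^ 6 * (1 + Real.log m) := by
  have hsub : (grid m).powerset.filter (fun Q => Q.card = 4 ∧ ColSet Q) ⊆
      (Finset.Icc 1 m).biUnion fun g =>
        ((grid m) ×ˢ (cube (m / g)) ×ˢ (Finset.range (g + 1)) ×ˢ (Finset.range (g + 1))).image
        fun t => ({t.1, t.1 + (g : ℤ) • t.2.1, t.1 + (t.2.2.1 : ℤ) • t.2.1,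
          t.1 + (t.2.2.2 : ℤ) • t.2.1} : Finset (Fin 3 → ℤ)) := by
    intro Q hQ
    rw [Finset.mem_filter, Finset.mem_powerset] at hQ
    obtain ⟨g, hg, x, hx, d, hd, i, hi, j, hj, rfl⟩ := quad_param hQ.1 hQ.2.1 hQ.2.2
    rw [Finset.mem_biUnion]
    refine ⟨g, hg, Finset.mem_image.2 ⟨(x, d, i, j), ?_, rfl⟩⟩
    simp only [Finset.mem_product]
    exact ⟨hx, hd, hi, hj⟩
  have h1 : ((grid m).powerset.filter (fun Q => Q.card = 4 ∧ ColSet Q)).card ≤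
      ∑ g ∈ Finset.Icc 1 m, m ^ 3 * ((2 * (m / g) + 1) ^ 3 * ((g + 1) * (g + 1))) := by
    refine (Finset.card_le_card hsub).trans (Finset.card_biUnion_le.trans ?_)
    apply Finset.sum_le_sum
    intro g _
    refine Finset.card_image_le.trans ?_
    simp [Finset.card_product, card_grid, card_cube]
  have h2 : (∑ g ∈ Finset.Icc 1 m, (1 : ℝ) / g) ≤ 1 + Real.log m := by
    have := harmonic_le_one_add_log m
    rw [harmonic_eq_sum_Icc] at this
    push_cast at this
    simpa using this
  calc (((grid m).powerset.filter (fun Q => Q.card = 4 ∧ ColSet Q)).card : ℝ)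
      ≤ ((∑ g ∈ Finset.Icc 1 m, m ^ 3 * ((2 * (m / g) + 1) ^ 3 * ((g + 1) * (g + 1))) : ℕ) : ℝ) := by
        exact_mod_cast h1
    _ ≤ ∑ g ∈ Finset.Icc 1 m, 108 * (m : ℝ) ^ 6 * (1 / g) := by
        push_cast
        apply Finset.sum_le_sum
        intro g hg
        rw [Finset.mem_Icc] at hg
        have hg1 : (1 : ℝ) ≤ g := by exact_mod_cast hg.1
        have hgm : (g : ℝ) ≤ m := by exact_mod_cast hg.2
        have a1 : ((m / g : ℕ) : ℝ) ≤ (m : ℝ) / g := Nat.cast_div_le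
        have a2 : 1 ≤ (m : ℝ) / g := by rw [le_div_iff₀ (by linarith)]; linarith
        calc (m : ℝ) ^ 3 * ((2 * ((m / g : ℕ) : ℝ) + 1) ^ 3 * (((g : ℝ) + 1) * (g + 1)))
            ≤ (m : ℝ) ^ 3 * ((3 * ((m : ℝ) / g)) ^ 3 * ((2 * g) * (2 * g))) := by
              gcongr <;> linarith
          _ = _ := by field_simp; ring
    _ = 108 * (m : ℝ) ^ 6 * ∑ g ∈ Finset.Icc 1 m, (1 : ℝ) / g := by rw [Finset.mul_sum]
    _ ≤ _ := by gcongr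

end Geom

section Proj

/-- The projection to the plane. -/
noncomputable def proj (θ : ℝ) (x : Fin 3 → ℤ) : Fin 2 → ℝ :=
  ![x 0 + θ * x 2, x 1 + θ ^ 2 * x 2]

lemma transc_quad {θ : ℝ} (hθ : Transcendental ℤ θ) {a b c : ℤ}
    (h : (a : ℝ) + θ * b + θ ^ 2 * c = 0) : a = 0 ∧ b = 0 ∧ c = 0 := by
  have hp : (Polynomial.monomial 0 a + Polynomial.monomial 1 b +
      Polynomial.monomial 2 c : Polynomial ℤ) = 0 := by
    by_contra hne
    apply hθ
    refine ⟨_, hne, ?_⟩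
    simp only [map_add, Polynomial.aeval_monomial]
    simp
    linarith
  have h0 := congrArg (fun p => Polynomial.coeff p 0) hp
  have h1 := congrArg (fun p => Polynomial.coeff p 1) hp
  have h2 := congrArg (fun p => Polynomial.coeff p 2) hp
  simp only [Polynomial.coeff_add, Polynomial.coeff_monomial, Polynomial.coeff_zero] at h0 h1 h2
  norm_num at h0 h1 h2
  exact ⟨h0, h1, h2⟩

lemma proj_inj {θ : ℝ} (hθ : Transcendental ℤ θ) : Function.Injective (proj θ) := by
  intro x y h
  have h0 := congrFun h 0
  have h1 := congrFun h 1
  simp [proj] at h0 h1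
  obtain ⟨a, b, -⟩ := transc_quad hθ (a := x 0 - y 0) (b := x 2 - y 2) (c := 0)
    (by push_cast; linarith)
  obtain ⟨c, -, -⟩ := transc_quad hθ (a := x 1 - y 1) (b := 0) (c := x 2 - y 2)
    (by push_cast; linarith)
  funext i
  fin_cases i
  · simp; omega
  · simp; omega
  · simp; omega

lemma col_of_proj {θ : ℝ} (hθ : Transcendental ℤ θ) {s : Set (Fin 2 → ℝ)}
    (hs : Collinear ℝ s) {x y z : Fin 3 → ℤ} (hx : proj θ x ∈ s) (hy : proj θ y ∈ s)
    (hz : proj θ z ∈ s) : Par (y - x) (z - x) := by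
  rw [collinear_iff_of_mem hx] at hs
  obtain ⟨v, hv⟩ := hs
  obtain ⟨r, hr⟩ := hv _ hy
  obtain ⟨t, ht⟩ := hv _ hz
  have r0 := congrFun hr 0
  have r1 := congrFun hr 1
  have t0 := congrFun ht 0
  have t1 := congrFun ht 1
  simp [proj] at r0 r1 t0 t1
  obtain ⟨u, hu⟩ : ∃ u, u = y - x := ⟨_, rfl⟩
  obtain ⟨w, hw⟩ : ∃ w, w = z - x := ⟨_, rfl⟩
  have u0 : (u 0 : ℝ) + θ * u 2 = r * v 0 := by rw [hu]; simp; linarith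
  have u1 : (u 1 : ℝ) + θ ^ 2 * u 2 = r * v 1 := by rw [hu]; simp; linarith
  have w0 : (w 0 : ℝ) + θ * w 2 = t * v 0 := by rw [hw]; simp; linarith
  have w1 : (w 1 : ℝ) + θ ^ 2 * w 2 = t * v 1 := by rw [hw]; simp; linarith
  obtain ⟨a, b, c⟩ := transc_quad hθ (a := u 0 * w 1 - u 1 * w 0) (b := u 2 * w 1 - u 1 * w 2)
    (c := u 0 * w 2 - u 2 * w 0) (by
      push_cast
      have : ((u 0 : ℝ) + θ * u 2) * (w 1 + θ ^ 2 * w 2) =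
          (u 1 + θ ^ 2 * u 2) * (w 0 + θ * w 2) := by
        rw [u0, u1, w0, w1]; ring
      linarith)
  rw [← hu, ← hw]
  intro i j
  fin_cases i <;> fin_cases j <;> simp <;> linarith

lemma proj_col (θ : ℝ) {x y z : Fin 3 → ℤ} (hxy : x ≠ y) (h : Par (y - x) (z - x)) :
    Collinear ℝ ({proj θ x, proj θ y, proj θ z} : Set (Fin 2 → ℝ)) := by
  rw [collinear_iff_of_mem (p₀ := proj θ x) (by simp)]
  obtain ⟨c, hc⟩ : ∃ c, y c - x c ≠ 0 := by
    by_contra h; push Not at h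
    exact hxy (funext fun i => by have := h i; omega)
  have hcR : ((y c : ℝ) - x c) ≠ 0 := by exact_mod_cast hc
  refine ⟨proj θ y - proj θ x, ?_⟩
  intro p hp
  simp only [Set.mem_insert_iff, Set.mem_singleton_iff] at hp
  rcases hp with rfl | rfl | rfl
  · exact ⟨0, by simp⟩
  · exact ⟨1, by simp⟩
  · obtain ⟨r, hrdef⟩ : ∃ r, r = ((z c : ℝ) - x c) / (y c - x c) := ⟨_, rfl⟩
    have hr : ∀ e, (z e : ℝ) - x e = r * (y e - x e) := by
      intro e
      have := h c e
      simp only [Pi.sub_apply] at this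
      have h2 : ((y c : ℝ) - x c) * (z e - x e) = (y e - x e) * (z c - x c) := by
        exact_mod_cast this
      rw [hrdef]; field_simp; linarith
    refine ⟨r, ?_⟩
    have e0 := hr 0
    have e1 := hr 1
    have e2 := hr 2
    funext i
    fin_cases i
    · simp [proj]; linear_combination e0 + θ * e2
    · simp [proj]; linear_combination e1 + θ ^ 2 * e2

lemma exists_transc : ∃ θ : ℝ, Transcendental ℤ θ :=
  ⟨_, transcendental_liouvilleNumber (m := 2) le_rfl⟩

end Proj
end GenPos

namespace GenPos

section Main

lemma exp_ineq {lam μ L : ℝ} (hl1 : lam ≤ 1) (hμ : 0 ≤ μ)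
    (h1 : Real.exp (-L) ≤ 1 / 2) (h2 : Real.exp (-L) ≤ μ / 2) :
    Real.exp (-μ) + lam * Real.exp (-L) ≤ 1 := by
  have h3 : Real.exp (-μ) ≤ 1 / (1 + μ) := by
    rw [Real.exp_neg, ← one_div]
    exact one_div_le_one_div_of_le (by linarith) (by linarith [Real.add_one_le_exp μ])
  have h4 : lam * Real.exp (-L) ≤ Real.exp (-L) := by
    nlinarith [Real.exp_pos (-L)]
  rcases le_total μ 1 with h | h
  · have : 1 / (1 + μ) ≤ 1 - μ / 2 := by
      rw [div_le_iff₀ (by linarith)]; nlinarith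
    linarith
  · have : 1 / (1 + μ) ≤ 1 / 2 := one_div_le_one_div_of_le (by norm_num) (by linarith)
    linarith

/-- Logarithmic factor. -/
noncomputable def ell (q : ℕ) : ℝ := 1 + Real.log q

lemma one_le_ell (q : ℕ) : 1 ≤ ell q := by
  have : 0 ≤ Real.log q := Real.log_natCast_nonneg q
  unfold ell; linarith

lemma exp_ell {q : ℕ} (hq : 1 ≤ q) : Real.exp (-(9 * ell q)) ≤ 1 / (2 * (q : ℝ) ^ 9) := by
  have hq0 : (0 : ℝ) < q := by exact_mod_cast hq
  have h1 : Real.exp (9 * ell q) = Real.exp 9 * (q : ℝ) ^ 9 := by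
    rw [ell, mul_add, Real.exp_add, mul_one]
    congr 1
    rw [show (9 : ℝ) = ((9 : ℕ) : ℝ) by norm_num, Real.exp_nat_mul, Real.exp_log hq0]
  rw [Real.exp_neg, ← one_div, h1]
  apply one_div_le_one_div_of_le (by positivity)
  gcongr
  linarith [Real.add_one_le_exp (9 : ℝ)]

lemma step {q : ℕ} (hq : 4 ≤ q) {lam Z0 : ℝ} (hl : 0 ≤ lam) (hl1 : lam ≤ 1) (hZ0 : 0 ≤ Z0)
    {A : Finset (Fin 3 → ℤ)} (hA : A ⊆ grid (q ^ 3)) (hAc : q ^ 8 ≤ A.card)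
    (hsmall : ∀ B ⊆ A, 64 * B.card ≤ 63 * A.card → partZ lam Good B ≤ Z0) :
    partZ lam Good A ≤ Z0 * Real.exp (300000 * ell q * (q : ℝ) ^ 5) := by
  have hq6 : 0 < 12 * q ^ 6 := by positivity
  obtain ⟨j, hj⟩ : ∃ j, j = Nat.sqrt (A.card / (12 * q ^ 6)) := ⟨_, rfl⟩
  have hlow : j * j * (12 * q ^ 6) ≤ A.card := by
    rw [← Nat.le_div_iff_mul_le hq6, hj]; exact Nat.sqrt_le _
  have hhigh : A.card < (j + 1) * (j + 1) * (12 * q ^ 6) := by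
    rw [← Nat.div_lt_iff_lt_mul hq6, hj]; exact Nat.lt_succ_sqrt _
  have hj1 : 1 ≤ j := by
    by_contra h
    have : j = 0 := by omega
    subst this
    have h1 : q ^ 8 = q ^ 6 * (q * q) := by ring
    have h2 : 16 ≤ q * q := by nlinarith
    nlinarith [Nat.pow_pos (n := 6) (show 0 < q by omega)]
  have hAtop : A.card ≤ q ^ 9 := by
    calc A.card ≤ _ := Finset.card_le_card hA
      _ = q ^ 9 := by rw [card_grid]; ring
  have hq6' : 0 < q ^ 6 := by positivity
  have hjq : j ≤ q ^ 3 := by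
    have h1 : j * (12 * q ^ 6) ≤ q ^ 3 * (12 * q ^ 6) := by
      calc j * (12 * q ^ 6) ≤ j * j * (12 * q ^ 6) :=
            Nat.mul_le_mul_right _ (Nat.le_mul_self j)
        _ ≤ q ^ 9 := hlow.trans hAtop
        _ = q ^ 3 * q ^ 6 := by ring
        _ ≤ q ^ 3 * (12 * q ^ 6) := by gcongr; omega
    exact Nat.le_of_mul_le_mul_right h1 hq6
  have hq7 : q ≤ 7 * j := by
    by_contra h
    push Not at h
    have h1 : q ^ 8 = (q * q) * q ^ 6 := by ring
    have h2 : (j + 1) * (j + 1) * 12 ≤ q * q := by nlinarith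
    have h3 : (j + 1) * (j + 1) * 12 * q ^ 6 ≤ (q * q) * q ^ 6 := Nat.mul_le_mul_right _ h2
    have h4 : (j + 1) * (j + 1) * (12 * q ^ 6) = (j + 1) * (j + 1) * 12 * q ^ 6 := by ring
    omega
  have hNj : A.card ≤ 48 * (j * j) * q ^ 6 := by
    have h2 : (j + 1) * (j + 1) * 12 ≤ 48 * (j * j) := by nlinarith
    have h3 : (j + 1) * (j + 1) * 12 * q ^ 6 ≤ 48 * (j * j) * q ^ 6 := Nat.mul_le_mul_right _ h2
    have h4 : (j + 1) * (j + 1) * (12 * q ^ 6) = (j + 1) * (j + 1) * 12 * q ^ 6 := by ring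
    omega
  obtain ⟨H, hH1, hH2, hH3, hH4, hH5⟩ := supersat (m := q ^ 3) (k := j ^ 2)
    (Nat.one_le_pow _ _ hj1) hA (by
      calc 12 * j ^ 2 * (q ^ 3) ^ 2 = j * j * (12 * q ^ 6) := by ring
        _ ≤ _ := hlow)
  have hl0 := one_le_ell q
  have hjR : (1 : ℝ) ≤ j := by exact_mod_cast hj1
  have hqR : (4 : ℝ) ≤ q := by exact_mod_cast hq
  have hjR3 : (0 : ℝ) < (j : ℝ) ^ 3 := by positivity
  have hexp := exp_ell (q := q) (by omega)
  have hj9 : (j : ℝ) ^ 3 ≤ (q : ℝ) ^ 9 := by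
    have : (j : ℝ) ≤ (q : ℝ) ^ 3 := by exact_mod_cast hjq
    calc (j : ℝ) ^ 3 ≤ ((q : ℝ) ^ 3) ^ 3 := by gcongr
      _ = _ := by ring
  have hres := container_step (lam := lam) (μ := 32 * (9 * ell q) / (j : ℝ) ^ 3)
    (ν := 32 * (9 * ell q) / (j : ℝ) ^ 6) (L := 9 * ell q) (Z0 := Z0) hl
    (by positivity) (by positivity) Good.anti hH1 hH2 hH3 hH4 hH5 (Δ := j ^ 3)
    (exp_ineq hl1 (by positivity) (hexp.trans (by
      apply one_div_le_one_div_of_le (by norm_num)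
      nlinarith [one_le_pow₀ (n := 9) (show (1 : ℝ) ≤ q by linarith)])) (hexp.trans (by
      calc 1 / (2 * (q : ℝ) ^ 9) ≤ 1 / (2 * (j : ℝ) ^ 3) := by
            apply one_div_le_one_div_of_le (by positivity); linarith
        _ = 1 / (j : ℝ) ^ 3 / 2 := by field_simp
        _ ≤ _ := by gcongr; linarith)))
    (by push_cast; apply le_of_eq; field_simp) (by push_cast; apply le_of_eq; field_simp)
    hZ0 hsmall
  refine hres.trans ?_
  refine mul_le_mul_of_nonneg_left (Real.exp_le_exp.2 ?_) hZ0
  have hNR : (A.card : ℝ) ≤ 48 * (j * j) * (q : ℝ) ^ 6 := by exact_mod_cast hNj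
  have hq7R : (q : ℝ) ≤ 7 * j := by exact_mod_cast hq7
  have hNdiv : (A.card : ℝ) / (j : ℝ) ^ 3 ≤ 336 * (q : ℝ) ^ 5 := by
    rw [div_le_iff₀ hjR3]
    calc (A.card : ℝ) ≤ 48 * (j * j) * (q : ℝ) ^ 5 * q := by linarith
      _ ≤ 48 * (j * j) * (q : ℝ) ^ 5 * (7 * j) := by gcongr
      _ = _ := by ring
  have hpos : 0 < ell q * (q : ℝ) ^ 5 := mul_pos (by linarith) (by positivity)
  calc _ = 864 * ell q * ((A.card : ℝ) / (j : ℝ) ^ 3) := by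
        push_cast; field_simp; ring
    _ ≤ 864 * ell q * (336 * (q : ℝ) ^ 5) := by gcongr
    _ ≤ _ := by nlinarith [hpos]

lemma iterate {q : ℕ} (hq : 4 ≤ q) {lam : ℝ} (hl : 0 ≤ lam) (hl1 : lam ≤ 1) (i : ℕ) :
    ∀ A ⊆ grid (q ^ 3), 63 ^ i * A.card ≤ 64 ^ i * q ^ 8 →
    partZ lam Good A ≤ Real.exp (lam * (q : ℝ) ^ 8 + i * (300000 * ell q * (q : ℝ) ^ 5)) := by
  have hl0 := one_le_ell q
  have base : ∀ i : ℕ, ∀ A : Finset (Fin 3 → ℤ), A.card ≤ q ^ 8 →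
      partZ lam Good A ≤ Real.exp (lam * (q : ℝ) ^ 8 + i * (300000 * ell q * (q : ℝ) ^ 5)) := by
    intro i A hA
    refine (partZ_le hl _ A).trans (Real.exp_le_exp.2 ?_)
    have : (A.card : ℝ) ≤ (q : ℝ) ^ 8 := by exact_mod_cast hA
    have h2 : lam * A.card ≤ lam * (q : ℝ) ^ 8 := by gcongr
    have h3 : 0 ≤ (i : ℝ) * (300000 * ell q * (q : ℝ) ^ 5) := by positivity
    linarith
  induction i with
  | zero =>
    intro A _ hA
    exact base 0 A (by simpa using hA)
  | succ i ih =>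
    intro A hA hAc
    by_cases hle : A.card ≤ q ^ 8
    · exact base _ A hle
    push Not at hle
    have := step hq hl hl1 (Real.exp_pos _).le hA hle.le (fun B hB hBc => ih B (hB.trans hA) (by
      have h1 : 63 ^ i * (64 * B.card) ≤ 63 ^ i * (63 * A.card) := Nat.mul_le_mul_left _ hBc
      have h2 : 64 * (63 ^ i * B.card) ≤ 64 * (64 ^ i * q ^ 8) := by
        calc _ = 63 ^ i * (64 * B.card) := by ring
          _ ≤ _ := h1
          _ = 63 ^ (i + 1) * A.card := by ring
          _ ≤ _ := hAc
          _ = _ := by ring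
      exact Nat.le_of_mul_le_mul_left h2 (by norm_num)))
    refine this.trans (le_of_eq ?_)
    rw [← Real.exp_add]; congr 1; push_cast; ring

lemma partZ_grid {q : ℕ} (hq : 4 ≤ q) {lam : ℝ} (hl : 0 ≤ lam) (hl1 : lam ≤ 1) :
    partZ lam Good (grid (q ^ 3)) ≤
      Real.exp (lam * (q : ℝ) ^ 8 + 19200000 * ell q ^ 2 * (q : ℝ) ^ 5) := by
  have hl0 := one_le_ell q
  have hq0 : (0 : ℝ) < q := by exact_mod_cast (show 0 < q by omega)
  obtain ⟨i, hi⟩ : ∃ i, i = ⌈64 * Real.log q⌉₊ := ⟨_, rfl⟩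
  have hi1 : 64 * Real.log q ≤ i := by rw [hi]; exact Nat.le_ceil _
  have hi2 : (i : ℝ) ≤ 64 * ell q := by
    have := Nat.ceil_lt_add_one (show 0 ≤ 64 * Real.log q by
      have := Real.log_natCast_nonneg q; positivity)
    rw [hi, ell]; linarith
  have hqi : (63 : ℝ) ^ i * q ≤ 64 ^ i := by
    have h1 : (63 : ℝ) / 64 ≤ Real.exp (-(1 / 64)) := by
      have := Real.add_one_le_exp (-(1 / 64) : ℝ)
      linarith
    have h2 : ((63 : ℝ) / 64) ^ i ≤ 1 / q := by
      calc ((63 : ℝ) / 64) ^ i ≤ Real.exp (-(1 / 64)) ^ i := by gcongr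
        _ = Real.exp (i * -(1 / 64)) := by rw [Real.exp_nat_mul]
        _ ≤ Real.exp (- Real.log q) := Real.exp_le_exp.2 (by linarith)
        _ = 1 / q := by rw [Real.exp_neg, Real.exp_log hq0, one_div]
    rw [div_pow, div_le_div_iff₀ (by positivity) hq0] at h2
    linarith
  have hqiN : 63 ^ i * q ≤ 64 ^ i := by exact_mod_cast hqi
  refine (iterate hq hl hl1 i _ subset_rfl ?_).trans (Real.exp_le_exp.2 ?_)
  · rw [card_grid]
    calc 63 ^ i * (q ^ 3) ^ 3 = 63 ^ i * q * q ^ 8 := by ring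
      _ ≤ 64 ^ i * q ^ 8 := Nat.mul_le_mul_right _ hqiN
  · have : (i : ℝ) * (300000 * ell q * (q : ℝ) ^ 5) ≤ 64 * ell q * (300000 * ell q * (q : ℝ) ^ 5) := by
      gcongr
    linarith

lemma delete {α : Type*} [DecidableEq α] (R : Finset α) (F : Finset (Finset α))
    (hF : ∀ Q ∈ F, Q.Nonempty) :
    ∃ S ⊆ R, R.card ≤ S.card + F.card ∧ ∀ Q ∈ F, ¬ Q ⊆ S := by
  have : ∀ Q : Finset α, ∃ x : Option α, Q ∈ F → ∃ y ∈ Q, x = some y := by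
    intro Q
    by_cases h : Q ∈ F
    · obtain ⟨y, hy⟩ := hF Q h
      exact ⟨some y, fun _ => ⟨y, hy, rfl⟩⟩
    · exact ⟨none, fun h' => absurd h' h⟩
  choose f hf using this
  refine ⟨R.filter (fun x => some x ∉ F.image f), Finset.filter_subset _ _, ?_, ?_⟩
  · rw [← Finset.card_filter_add_card_filter_not (s := R) (fun x => some x ∉ F.image f)]
    gcongr
    calc _ = ((R.filter (fun x => ¬ some x ∉ F.image f)).image some).card :=
          (Finset.card_image_of_injective _ (Option.some_injective α)).symm
      _ ≤ (F.image f).card := by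
          apply Finset.card_le_card
          intro y hy
          obtain ⟨x, hx, rfl⟩ := Finset.mem_image.1 hy
          exact not_not.1 (Finset.mem_filter.1 hx).2
      _ ≤ F.card := Finset.card_image_le
  · intro Q hQ hsub
    obtain ⟨y, hy, hfy⟩ := hf Q hQ
    apply (Finset.mem_filter.1 (hsub hy)).2
    rw [← hfy]
    exact Finset.mem_image_of_mem f hQ

lemma core {q n : ℕ} (hq : 4 ≤ q) (hn : 1 ≤ n) (hnq : (n : ℝ) + 1 ≤ (q : ℝ) ^ 6 / (2000 * ell q)) :
    ∃ S : Finset (Fin 3 → ℤ), n ≤ S.card ∧ (∀ Q ⊆ S, Q.card = 4 → ¬ ColSet Q) ∧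
      ∀ T ⊆ S, Good T → (T.card : ℝ) ≤ 50000000 * ell q ^ 2 * (q : ℝ) ^ 5 := by
  classical
  have hl0 := one_le_ell q
  have hq0 : (4 : ℝ) ≤ q := by exact_mod_cast hq
  obtain ⟨p, hp⟩ : ∃ p : ℝ, p = 1 / (1000 * ell q * (q : ℝ) ^ 3) := ⟨_, rfl⟩
  obtain ⟨t, ht⟩ : ∃ t, t = ⌈50000000 * ell q ^ 2 * (q : ℝ) ^ 5⌉₊ := ⟨_, rfl⟩
  have hp0 : 0 < p := by rw [hp]; positivity
  have hq3 : (1 : ℝ) ≤ (q : ℝ) ^ 3 := one_le_pow₀ (by linarith)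
  have hq5 : (1 : ℝ) ≤ (q : ℝ) ^ 5 := one_le_pow₀ (by linarith)
  have hlq : 1 ≤ ell q * (q : ℝ) ^ 3 := one_le_mul_of_one_le_of_one_le hl0 hq3
  have hp1 : p ≤ 1 / 1000 := by
    rw [hp]
    apply one_div_le_one_div_of_le (by norm_num)
    linarith
  obtain ⟨Vg, hVg⟩ : ∃ Vg, Vg = grid (q ^ 3) := ⟨_, rfl⟩
  have hVc : (Vg.card : ℝ) = (q : ℝ) ^ 9 := by rw [hVg, card_grid]; push_cast; ring
  -- bound on the weighted number of good sets
  have hZ : partZ (2 * p) Good Vg ≤ Real.exp (20000000 * ell q ^ 2 * (q : ℝ) ^ 5) := by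
    rw [hVg]
    refine (partZ_grid hq (by positivity) (by linarith)).trans (Real.exp_le_exp.2 ?_)
    have h1 : 2 * p * (q : ℝ) ^ 8 ≤ (q : ℝ) ^ 5 := by
      calc 2 * p * (q : ℝ) ^ 8 = (q : ℝ) ^ 5 * (1 / (500 * ell q)) := by
            rw [hp]; field_simp; ring
        _ ≤ (q : ℝ) ^ 5 * 1 := by
            gcongr
            rw [div_le_one (by positivity)]; linarith
        _ = _ := mul_one _
    have h2 : 1 ≤ ell q ^ 2 := one_le_pow₀ hl0
    nlinarith
  have hgoodsum : ∑ B ∈ Vg.powerset.filter (fun B => B.card = t ∧ Good B), p ^ B.card ≤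
      1 / (q : ℝ) ^ 9 := by
    have h1 : ∑ B ∈ Vg.powerset.filter (fun B => B.card = t ∧ Good B), p ^ B.card ≤
        (1 / 2) ^ t * partZ (2 * p) Good Vg := by
      unfold partZ
      rw [Finset.mul_sum]
      calc _ = ∑ B ∈ Vg.powerset.filter (fun B => B.card = t ∧ Good B),
            (1 / 2) ^ t * (2 * p) ^ B.card := by
            apply Finset.sum_congr rfl
            intro B hB
            rw [(Finset.mem_filter.1 hB).2.1, ← mul_pow]
            congr 1; ring
        _ ≤ _ := by
            apply Finset.sum_le_sum_of_subset_of_nonneg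
            · intro B hB
              rw [Finset.mem_filter] at hB ⊢
              exact ⟨hB.1, hB.2.2⟩
            · intros; positivity
    have h2 : ((1 : ℝ) / 2) ^ t ≤ Real.exp (-(t / 2)) := by
      have h3 : (1 : ℝ) / 2 ≤ Real.exp (-(1 / 2)) := by
        have := Real.add_one_le_exp (-(1 / 2) : ℝ)
        linarith
      calc ((1 : ℝ) / 2) ^ t ≤ Real.exp (-(1 / 2)) ^ t := by gcongr
        _ = Real.exp (t * -(1 / 2)) := by rw [Real.exp_nat_mul]
        _ = _ := by congr 1; ring
    have ht' : 50000000 * ell q ^ 2 * (q : ℝ) ^ 5 ≤ t := by rw [ht]; exact Nat.le_ceil _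
    have hlq2 : ell q ≤ ell q ^ 2 * (q : ℝ) ^ 5 := by
      have : ell q * 1 ≤ ell q * (ell q * (q : ℝ) ^ 5) := by
        gcongr
        exact one_le_mul_of_one_le_of_one_le hl0 hq5
      nlinarith
    calc _ ≤ _ := h1
      _ ≤ Real.exp (-(t / 2)) * Real.exp (20000000 * ell q ^ 2 * (q : ℝ) ^ 5) := by
          gcongr
          exact partZ_nonneg (by positivity) _ _
      _ = Real.exp (-(t / 2) + 20000000 * ell q ^ 2 * (q : ℝ) ^ 5) := by rw [Real.exp_add]
      _ ≤ Real.exp (-(9 * ell q)) := Real.exp_le_exp.2 (by linarith)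
      _ ≤ 1 / (2 * (q : ℝ) ^ 9) := exp_ell (by omega)
      _ ≤ 1 / (q : ℝ) ^ 9 := by
          apply one_div_le_one_div_of_le (by positivity)
          have : 0 < (q : ℝ) ^ 9 := by positivity
          linarith
  have hquad : ∑ B ∈ Vg.powerset.filter (fun B => B.card = 4 ∧ ColSet B), p ^ B.card ≤
      (q : ℝ) ^ 6 / (2000 * ell q) := by
    calc _ = ∑ B ∈ Vg.powerset.filter (fun B => B.card = 4 ∧ ColSet B), p ^ 4 := by
          apply Finset.sum_congr rfl
          intro B hB
          rw [(Finset.mem_filter.1 hB).2.1]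
      _ = (Vg.powerset.filter (fun B => B.card = 4 ∧ ColSet B)).card * p ^ 4 := by
          rw [Finset.sum_const, nsmul_eq_mul]
      _ ≤ (108 * ((q ^ 3 : ℕ) : ℝ) ^ 6 * (1 + Real.log ((q ^ 3 : ℕ) : ℝ))) * p ^ 4 := by
          gcongr
          rw [hVg]
          convert card_quads (m := q ^ 3) (Nat.one_le_pow _ _ (by omega))
      _ ≤ (108 * (q : ℝ) ^ 18 * (3 * ell q)) * p ^ 4 := by
          gcongr
          · push_cast; apply le_of_eq; ring
          · push_cast
            rw [Real.log_pow, ell]; push_cast; linarith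
      _ = (q : ℝ) ^ 6 / (2000 * ell q) * (324 * 2000 / (1000 ^ 4 * ell q ^ 2)) := by
          rw [hp]; field_simp; norm_num
      _ ≤ (q : ℝ) ^ 6 / (2000 * ell q) * 1 := by
          gcongr
          rw [div_le_one (by positivity)]
          nlinarith
      _ = _ := mul_one _
  obtain ⟨R, hR, hRsum⟩ := exists_ge_expect hp0.le (by linarith) Vg
    (fun B => (if B.card = 1 then 1 else 0) - (if B.card = 4 ∧ ColSet B then 1 else 0)
      - (q : ℝ) ^ 9 * (if B.card = t ∧ Good B then 1 else 0))
  have hone : ∀ W : Finset (Fin 3 → ℤ), ∀ c : ℝ,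
      ∑ B ∈ W.powerset, (if B.card = 1 then 1 else 0) * c ^ B.card = W.card * c := by
    intro W c
    simp only [ite_mul, one_mul, zero_mul]
    rw [← Finset.sum_filter, ← Finset.powersetCard_eq_filter]
    rw [Finset.sum_congr rfl (g := fun _ => c)]
    · simp
    · intro B hB
      rw [(Finset.mem_powersetCard.1 hB).2, pow_one]
  have hexpand : ∀ W : Finset (Fin 3 → ℤ), ∀ c : ℝ,
      ∑ B ∈ W.powerset, ((if B.card = 1 then 1 else 0) - (if B.card = 4 ∧ ColSet B then 1 else 0)
      - (q : ℝ) ^ 9 * (if B.card = t ∧ Good B then 1 else 0)) * c ^ B.card = W.card * c -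
      ∑ B ∈ W.powerset.filter (fun B => B.card = 4 ∧ ColSet B), c ^ B.card -
      (q : ℝ) ^ 9 * ∑ B ∈ W.powerset.filter (fun B => B.card = t ∧ Good B), c ^ B.card := by
    intro W c
    rw [← hone W c, Finset.sum_filter, Finset.sum_filter, Finset.mul_sum,
      ← Finset.sum_sub_distrib, ← Finset.sum_sub_distrib]
    apply Finset.sum_congr rfl
    intro B _
    split_ifs <;> ring
  have hR1 := hexpand R 1
  simp only [one_pow, mul_one, Finset.sum_const, nsmul_eq_mul] at hR1
  rw [hR1, hexpand Vg p, hVc] at hRsum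
  have hfin : (n : ℝ) ≤ R.card -
      ((R.powerset.filter (fun B => B.card = 4 ∧ ColSet B)).card : ℝ) -
      (q : ℝ) ^ 9 * ((R.powerset.filter (fun B => B.card = t ∧ Good B)).card : ℝ) := by
    refine le_trans ?_ hRsum
    have h1 : (q : ℝ) ^ 9 * p = 2 * ((q : ℝ) ^ 6 / (2000 * ell q)) := by
      rw [hp]; field_simp; ring
    have h2 : (q : ℝ) ^ 9 * ∑ B ∈ Vg.powerset.filter (fun B => B.card = t ∧ Good B), p ^ B.card ≤ 1 := by
      calc _ ≤ (q : ℝ) ^ 9 * (1 / (q : ℝ) ^ 9) := by gcongr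
        _ = 1 := by field_simp
    linarith
  have hRV : (R.card : ℝ) ≤ (q : ℝ) ^ 9 := by
    rw [← hVc]; exact_mod_cast Finset.card_le_card hR
  have hnogood : (R.powerset.filter (fun B => B.card = t ∧ Good B)).card = 0 := by
    by_contra h
    have h1 : (1 : ℝ) ≤ ((R.powerset.filter (fun B => B.card = t ∧ Good B)).card : ℝ) := by
      exact_mod_cast Nat.one_le_iff_ne_zero.2 h
    have h2 : (1 : ℝ) ≤ n := by exact_mod_cast hn
    have h3 : (0 : ℝ) ≤ ((R.powerset.filter (fun B => B.card = 4 ∧ ColSet B)).card : ℝ) := by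
      positivity
    have h4 : 0 ≤ (q : ℝ) ^ 9 := by positivity
    nlinarith
  obtain ⟨S, hSR, hSc, hSQ⟩ := delete R (R.powerset.filter (fun B => B.card = 4 ∧ ColSet B)) (by
    intro Q hQ
    rw [← Finset.card_pos, (Finset.mem_filter.1 hQ).2.1]; norm_num)
  refine ⟨S, ?_, ?_, ?_⟩
  · rw [hnogood] at hfin
    have : (R.card : ℝ) ≤ S.card +
      ((R.powerset.filter (fun B => B.card = 4 ∧ ColSet B)).card : ℝ) := by exact_mod_cast hSc
    have : (n : ℝ) ≤ S.card := by
      simp only [Nat.cast_zero, mul_zero, sub_zero] at hfin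
      linarith
    exact_mod_cast this
  · intro Q hQ hc hcol
    exact hSQ Q (Finset.mem_filter.2 ⟨Finset.mem_powerset.2 (hQ.trans hSR), hc, hcol⟩) hQ
  · intro T hT hg
    by_contra hlt
    push Not at hlt
    have : t ≤ T.card := by rw [ht]; exact Nat.ceil_le.2 hlt.le
    obtain ⟨T', hT', hTc⟩ := Finset.exists_subset_card_eq this
    rw [Finset.card_eq_zero] at hnogood
    have hmem : T' ∈ R.powerset.filter (fun B => B.card = t ∧ Good B) :=
      Finset.mem_filter.2 ⟨Finset.mem_powerset.2 ((hT'.trans hT).trans hSR), hTc,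
        Good.anti _ _ hT' hg⟩
    rw [hnogood] at hmem
    exact absurd hmem (Finset.notMem_empty _)

lemma plane {n : ℕ} {b : ℝ} {S : Finset (Fin 3 → ℤ)} (hn : n ≤ S.card)
    (h4 : ∀ Q ⊆ S, Q.card = 4 → ¬ ColSet Q) (h3 : ∀ T ⊆ S, Good T → (T.card : ℝ) ≤ b) :
    ∃ S : Finset (Fin 2 → ℝ), S.card = n ∧
        (∀ Q ⊆ S, Q.card = 4 → ¬ Collinear ℝ (Q : Set (Fin 2 → ℝ))) ∧
        ∀ T ⊆ S, (∀ Q ⊆ T, Q.card = 3 → ¬ Collinear ℝ (Q : Set (Fin 2 → ℝ))) →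
          (T.card : ℝ) ≤ b := by
  classical
  obtain ⟨θ, hθ⟩ := exists_transc
  have hinj := proj_inj hθ
  obtain ⟨S', hS', hc⟩ := Finset.exists_subset_card_eq hn
  refine ⟨S'.image (proj θ), by rw [Finset.card_image_of_injective _ hinj, hc], ?_, ?_⟩
  · intro Q hQ hQc hcol
    obtain ⟨Q', hQ', rfl⟩ := Finset.subset_image_iff.1 hQ
    rw [Finset.card_image_of_injective _ hinj] at hQc
    refine h4 Q' (Finset.Subset.trans (by exact_mod_cast hQ') hS') hQc ?_
    intro x hx y hy z hz
    exact col_of_proj hθ hcol (by simpa using ⟨x, hx, rfl⟩) (by simpa using ⟨y, hy, rfl⟩)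
      (by simpa using ⟨z, hz, rfl⟩)
  · intro T hT hgen
    obtain ⟨T', hT', rfl⟩ := Finset.subset_image_iff.1 hT
    rw [Finset.card_image_of_injective _ hinj]
    refine h3 T' (Finset.Subset.trans (by exact_mod_cast hT') hS') ?_
    intro x hx y hy z hz hxy hyz hxz hpar
    refine hgen ({proj θ x, proj θ y, proj θ z} : Finset (Fin 2 → ℝ)) ?_ ?_ ?_
    · intro w hw
      simp only [Finset.mem_insert, Finset.mem_singleton] at hw
      rcases hw with rfl | rfl | rfl <;> exact Finset.mem_image_of_mem _ (by assumption)
    · exact Finset.card_eq_three.2 ⟨_, _, _, hinj.ne hxy, hinj.ne hxz, hinj.ne hyz, rfl⟩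
    · have := proj_col θ hxy hpar
      simpa using this

lemma eventually_log {η : ℝ} (hη : 0 < η) :
    ∃ n₀ : ℕ, ∀ n : ℕ, n₀ ≤ n → 10 ^ 10 * (1 + 2 * Real.log n) ^ 2 ≤ (n : ℝ) ^ η := by
  have h1 := (isLittleO_log_rpow_atTop (show 0 < η / 2 by positivity)).def
    (show (0 : ℝ) < 1 / (3 * 10 ^ 5) by norm_num)
  have h2 := tendsto_natCast_atTop_atTop (R := ℝ) |>.eventually
    (h1.and (Filter.eventually_ge_atTop (Real.exp 1)))
  obtain ⟨n₀, hn₀⟩ := Filter.eventually_atTop.1 h2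
  refine ⟨n₀, fun n hn => ?_⟩
  obtain ⟨ha, hb⟩ := hn₀ n hn
  have hn0 : (0 : ℝ) < n := lt_of_lt_of_le (Real.exp_pos 1) hb
  have hlog : 1 ≤ Real.log n := by rwa [Real.le_log_iff_exp_le hn0]
  rw [Real.norm_of_nonneg (by linarith), Real.norm_of_nonneg (by positivity)] at ha
  have h3 : 10 ^ 5 * (1 + 2 * Real.log n) ≤ (n : ℝ) ^ (η / 2) := by
    linarith
  calc 10 ^ 10 * (1 + 2 * Real.log n) ^ 2 = (10 ^ 5 * (1 + 2 * Real.log n)) ^ 2 := by ring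
    _ ≤ ((n : ℝ) ^ (η / 2)) ^ 2 := by gcongr
    _ = (n : ℝ) ^ η := by
      rw [← Real.rpow_natCast, ← Real.rpow_mul hn0.le]; congr 1; push_cast; ring

end Main
end GenPos

theorem points_in_general_position_upper_bound :
    ∀ ε : ℝ, 0 < ε → ∃ n₀ : ℕ, ∀ n : ℕ, n₀ ≤ n →
      ∃ S : Finset (Fin 2 → ℝ), S.card = n ∧
        (∀ Q ⊆ S, Q.card = 4 → ¬ Collinear ℝ (Q : Set (Fin 2 → ℝ))) ∧
        ∀ T ⊆ S, (∀ Q ⊆ T, Q.card = 3 → ¬ Collinear ℝ (Q : Set (Fin 2 → ℝ))) →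
          (T.card : ℝ) ≤ (n : ℝ) ^ ((5 : ℝ) / 6 + ε) := by
  intro ε hε
  obtain ⟨η, hη⟩ : ∃ η, η = min ε 1 / 6 := ⟨_, rfl⟩
  have hη0 : 0 < η := by rw [hη]; positivity
  have hηε : 6 * η ≤ ε := by rw [hη]; linarith [min_le_left ε 1]
  have hη1 : η ≤ 1 / 6 := by rw [hη]; linarith [min_le_right ε 1]
  obtain ⟨n₀, hn₀⟩ := GenPos.eventually_log hη0
  refine ⟨max n₀ 1000000, fun n hn => ?_⟩
  have hlog := hn₀ n (le_trans (le_max_left _ _) hn)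
  have hn6 : 1000000 ≤ n := le_trans (le_max_right _ _) hn
  have hnR : (1000000 : ℝ) ≤ n := by exact_mod_cast hn6
  have hn0 : (0 : ℝ) < n := by linarith
  have hn1 : (1 : ℝ) ≤ n := by linarith
  obtain ⟨X, hX⟩ : ∃ X : ℝ, X = (n : ℝ) ^ ((1 : ℝ) / 6 + η) := ⟨_, rfl⟩
  have hX10 : 10 ≤ X := by
    calc (10 : ℝ) = (1000000 : ℝ) ^ ((1 : ℝ) / 6) := by
          rw [show (1000000 : ℝ) = 10 ^ (6 : ℝ) by norm_num, ← Real.rpow_mul (by norm_num)]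
          norm_num
      _ ≤ (n : ℝ) ^ ((1 : ℝ) / 6) := by gcongr
      _ ≤ X := by rw [hX]; exact Real.rpow_le_rpow_of_exponent_le hn1 (by linarith)
  obtain ⟨q, hq⟩ : ∃ q, q = ⌈X⌉₊ := ⟨_, rfl⟩
  have hqX : X ≤ q := by rw [hq]; exact Nat.le_ceil _
  have hqX2 : (q : ℝ) ≤ 2 * X := by
    have := Nat.ceil_lt_add_one (show 0 ≤ X by linarith)
    rw [hq]; linarith
  have hq4 : 4 ≤ q := by
    have : (4 : ℝ) ≤ q := by linarith
    exact_mod_cast this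
  have hell : GenPos.ell q ≤ 1 + 2 * Real.log n := by
    have hqn : (q : ℝ) ≤ (n : ℝ) ^ 2 := by
      have : X ≤ n := by
        rw [hX]
        calc (n : ℝ) ^ ((1 : ℝ) / 6 + η) ≤ (n : ℝ) ^ (1 : ℝ) :=
              Real.rpow_le_rpow_of_exponent_le hn1 (by linarith)
          _ = n := Real.rpow_one _
      nlinarith
    have := Real.log_le_log (by linarith) hqn
    rw [Real.log_pow] at this
    unfold GenPos.ell
    push_cast at this
    linarith
  have hl0 := GenPos.one_le_ell q
  have hel2 : 10 ^ 10 * GenPos.ell q ^ 2 ≤ (n : ℝ) ^ η := by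
    refine le_trans ?_ hlog
    gcongr
  have hXpow : ∀ k : ℕ, X ^ k = (n : ℝ) ^ (((1 : ℝ) / 6 + η) * k) := by
    intro k
    rw [hX, ← Real.rpow_natCast, ← Real.rpow_mul hn0.le]
  obtain ⟨S, hS1, hS2, hS3⟩ := GenPos.core hq4 (show 1 ≤ n by omega) (by
    rw [le_div_iff₀ (by positivity)]
    calc ((n : ℝ) + 1) * (2000 * GenPos.ell q) ≤ (2 * n) * (2000 * GenPos.ell q ^ 2) := by
          gcongr
          · linarith
          · nlinarith
      _ ≤ n * (10 ^ 10 * GenPos.ell q ^ 2) := by nlinarith [mul_pos hn0 (pow_pos (show 0 < GenPos.ell q by linarith) 2)]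
      _ ≤ n * (n : ℝ) ^ η := by gcongr
      _ = (n : ℝ) ^ (1 + η) := by rw [Real.rpow_add hn0, Real.rpow_one]
      _ ≤ X ^ 6 := by
          rw [hXpow]
          exact Real.rpow_le_rpow_of_exponent_le hn1 (by push_cast; linarith)
      _ ≤ (q : ℝ) ^ 6 := by gcongr)
  refine GenPos.plane hS1 hS2 fun T hT hg => (hS3 T hT hg).trans ?_
  calc 50000000 * GenPos.ell q ^ 2 * (q : ℝ) ^ 5 ≤ 50000000 * GenPos.ell q ^ 2 * (2 * X) ^ 5 := by
        gcongr
    _ ≤ 10 ^ 10 * GenPos.ell q ^ 2 * X ^ 5 := by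
        have : 0 ≤ GenPos.ell q ^ 2 * X ^ 5 := by positivity
        nlinarith
    _ ≤ (n : ℝ) ^ η * X ^ 5 := by gcongr
    _ = (n : ℝ) ^ (η + ((1 : ℝ) / 6 + η) * (5 : ℕ)) := by rw [hXpow, Real.rpow_add hn0]
    _ ≤ _ := Real.rpow_le_rpow_of_exponent_le hn1 (by push_cast; linarith)
end

section
/- There exists r₀ such that for every integer r ≥ r₀, setting T := r^{5r²}, there exist a finite set P of points in ℝ² and a finite set L of lines in ℝ² such that: (a) every point of P lies on at least r lines of L; (b) for every line ℓ ∈ L, the number of lines ℓ' ∈ L with ℓ' ≠ ℓ such that ℓ ∩ ℓ' contains a point of P is at most T; and (c) L cannot be partitioned into two subfamilies each of which covers P (i.e., in any partition L = L₁ ∪ L₂ some point of P misses all lines of L₁ or all lines of L₂). -/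
/-- A line in the plane: a one-dimensional affine subspace of ℝ², viewed as a set of points. -/
def IsLine (L : Set (Fin 2 → ℝ)) : Prop :=
  ∃ u v : Fin 2 → ℝ, v ≠ 0 ∧ L = {p | ∃ t : ℝ, p = u + t • v}

section

open Finset

noncomputable section
open Classical in
/-- partition function of the subsets of `D` with property `p`. -/
def PF {V : Type} (z : ℝ) (D : Finset V) (p : Finset V → Prop) : ℝ :=
  ∑ I ∈ D.powerset with p I, z ^ #I

theorem PF_mono {V : Type} {z : ℝ} (hz : 0 ≤ z) {D D' : Finset V} {p p' : Finset V → Prop}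
    (h : ∀ I, I ⊆ D → p I → I ⊆ D' ∧ p' I) : PF z D p ≤ PF z D' p' := by
  classical
  unfold PF
  apply Finset.sum_le_sum_of_subset_of_nonneg
  · intro I hI
    simp only [mem_filter, mem_powerset] at hI ⊢
    exact h I hI.1 hI.2
  · intros; positivity

theorem PF_le {V : Type} {z : ℝ} (hz : 0 ≤ z) (D : Finset V) (p : Finset V → Prop) :
    PF z D p ≤ (1 + z) ^ #D := by
  classical
  have := Finset.sum_pow_mul_eq_add_pow z 1 D
  rw [add_comm, ← this]
  unfold PF
  simp only [one_pow, mul_one]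
  apply Finset.sum_le_sum_of_subset_of_nonneg (filter_subset _ _)
  intros; positivity

theorem PF_split {V : Type} [DecidableEq V] (z : ℝ) (D : Finset V) (p : Finset V → Prop) (v : V)
    (hv : v ∈ D) :
    PF z D p = PF z (D.erase v) p + z * PF z (D.erase v) (fun I => p (insert v I)) := by
  classical
  unfold PF
  rw [sum_filter, sum_filter, sum_filter]
  conv_lhs => rw [← insert_erase hv]
  rw [sum_powerset_insert (notMem_erase v D), mul_sum]
  congr 1
  apply sum_congr rfl
  intro I hI
  have : v ∉ I := fun h => notMem_erase v D (mem_powerset.1 hI h)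
  rw [card_insert_of_notMem this, pow_succ]
  split_ifs <;> ring

def LineFree {V : Type} [DecidableEq V] (Ls : Finset (Finset V)) (r : ℕ) (I : Finset V) : Prop :=
  ∀ l ∈ Ls, #(I ∩ l) < r

theorem LineFree.mono {V : Type} [DecidableEq V] {Ls : Finset (Finset V)} {r : ℕ}
    {I J : Finset V} (h : LineFree Ls r J) (hIJ : I ⊆ J) : LineFree Ls r I :=
  fun l hl => lt_of_le_of_lt (card_le_card (inter_subset_inter_right hIJ)) (h l hl)

/-- Existence of a vertex of large degree. -/
theorem exists_vertex {V : Type} [DecidableEq V] [Fintype V]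
    (N c m h k M Δ Δ' : ℕ) (D0 D : Finset V)
    (hD : D ⊆ D0) (hc : #D0 < #D + c) (C C' : Finset (Finset V)) (S S' : Finset V → Finset V)
    (hC : ∀ l ∈ C, S l ⊆ D0 ∧ k + 1 ≤ #(S l))
    (hdeg : ∀ x, #{l ∈ C | x ∈ S l} ≤ Δ) (hM : M ≤ #C)
    (hC'2 : ∀ l ∈ C', #(S' l) ≤ N)
    (hC'3 : #C' ≤ m * h)
    (h0 : 0 < M) (hpos : 0 < Δ')
    (h1 : 5 * (m * h) ≤ M) (h2 : 5 * (c * Δ) ≤ M) (h3 : 5 * (m * h * N * Δ) ≤ M * Δ')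
    (h4 : 5 * (Fintype.card V * h) ≤ M) :
    ∃ v ∈ D, h ≤ #{l ∈ C \ C' | v ∈ S l ∧ k + 1 ≤ #{x ∈ S l | #{l ∈ C' | x ∈ S' l} < Δ'}} := by
  by_contra! hcon
  set U : V → Prop := fun x => #{l ∈ C' | x ∈ S' l} < Δ' with hU
  set Sat : Finset V := {x | ¬ U x} with hSat
  set good : Finset (Finset V) := {l ∈ C \ C' | k + 1 ≤ #{x ∈ S l | U x}} with hgood
  set bad : Finset (Finset V) := {l ∈ C \ C' | ¬ (k + 1 ≤ #{x ∈ S l | U x})} with hbad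
  have e1 : #good + #bad = #(C \ C') := card_filter_add_card_filter_not _
  have e2 : #C ≤ #(C \ C') + #C' := by
    have := le_card_sdiff C' C
    omega
  -- saturated
  have e3 : #Sat * Δ' ≤ #C' * N := by
    apply Finset.card_mul_le_card_mul (fun x l => x ∈ S' l)
    · intro x hx
      simp only [hSat, hU, mem_filter, not_lt] at hx
      simpa [bipartiteAbove] using hx.2
    · intro l hl
      refine le_trans (card_le_card ?_) (hC'2 l hl)
      intro x hx
      simp only [bipartiteBelow, mem_filter] at hx
      exact hx.2
  have e4 : #bad * 1 ≤ #Sat * Δ := by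
    apply Finset.card_mul_le_card_mul (fun l x => x ∈ S l)
    · intro l hl
      simp only [hbad, mem_filter, mem_sdiff] at hl
      have h5 := hC l hl.1.1
      have : #{x ∈ S l | U x} + #{x ∈ S l | ¬ U x} = #(S l) := card_filter_add_card_filter_not _
      have h6 : 1 ≤ #{x ∈ S l | ¬ U x} := by omega
      refine h6.trans (card_le_card ?_)
      intro x hx
      simp only [mem_filter, bipartiteAbove, hSat, mem_univ, true_and] at hx ⊢
      exact ⟨hx.2, hx.1⟩
    · intro x hx
      refine le_trans (card_le_card ?_) (hdeg x)
      intro l hl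
      simp only [bipartiteBelow, mem_filter, hbad, mem_sdiff] at hl ⊢
      exact ⟨hl.1.1.1, hl.2⟩
  have e5 : #good ≤ #D * h + #(D0 \ D) * Δ := by
    have : #good ≤ ∑ l ∈ good, #(S l) := by
      rw [card_eq_sum_ones]
      apply sum_le_sum
      intro l hl
      simp only [hgood, mem_filter, mem_sdiff] at hl
      have := (hC l hl.1.1).2
      omega
    refine this.trans ?_
    have : ∑ l ∈ good, #(S l) = ∑ x ∈ D0, #{l ∈ good | x ∈ S l} := by
      have hb := sum_card_bipartiteAbove_eq_sum_card_bipartiteBelow (s := D0) (t := good)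
        (fun x l => x ∈ S l)
      refine Eq.trans ?_ hb.symm
      apply sum_congr rfl
      intro l hl
      simp only [hgood, mem_filter, mem_sdiff] at hl
      congr 1
      ext x
      simp only [bipartiteBelow, mem_filter]
      exact ⟨fun hx => ⟨(hC l hl.1.1).1 hx, hx⟩, fun hx => hx.2⟩
    rw [this, ← sum_sdiff hD, add_comm]
    apply add_le_add
    · rw [← smul_eq_mul]
      apply sum_le_card_nsmul
      intro v hv
      refine le_trans (card_le_card ?_) (hcon v hv).le
      intro l hl
      simp only [hgood, mem_filter] at hl ⊢
      exact ⟨hl.1.1, hl.2, hl.1.2⟩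
    · rw [← smul_eq_mul]
      apply sum_le_card_nsmul
      intro v hv
      refine le_trans (card_le_card ?_) (hdeg v)
      intro l hl
      simp only [hgood, mem_filter, mem_sdiff] at hl ⊢
      exact ⟨hl.1.1.1, hl.2⟩
  have e6 : #(D0 \ D) ≤ c := by
    rw [card_sdiff_of_subset hD]; omega
  have e7 : #(D0 \ D) * Δ ≤ c * Δ := Nat.mul_le_mul_right _ e6
  have e8 : #D * h ≤ Fintype.card V * h := Nat.mul_le_mul_right _ (card_le_univ _)
  -- Sat * Δ ≤ M/5
  have e9 : 5 * (#Sat * Δ) ≤ M := by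
    have : 5 * (#Sat * Δ) * Δ' ≤ M * Δ' := by
      calc 5 * (#Sat * Δ) * Δ' = 5 * ((#Sat * Δ') * Δ) := by ring
        _ ≤ 5 * ((m * h * N) * Δ) :=
          Nat.mul_le_mul_left _ (Nat.mul_le_mul_right _
            (e3.trans (Nat.mul_le_mul_right _ hC'3)))
        _ ≤ M * Δ' := h3
    exact Nat.le_of_mul_le_mul_right this hpos
  omega

/-- The core counting lemma. -/
theorem core {V : Type} [DecidableEq V] [Fintype V]
    (Ls : Finset (Finset V)) (N r c m : ℕ) (M Δ h : ℕ → ℕ) (z lam Y : ℝ)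
    (hz : 0 ≤ z) (hlam : 1 ≤ lam) (hY : 0 ≤ Y)
    (hLN : ∀ l ∈ Ls, #l ≤ N)
    (hlin : ∀ l ∈ Ls, ∀ l' ∈ Ls, ∀ x y, x ≠ y → x ∈ l → x ∈ l' → y ∈ l → y ∈ l' → l = l')
    (D0 : Finset V)
    (hD0 : ∀ D', #D' + c ≤ #D0 → PF z D' (LineFree Ls r) ≤ Y)
    (hM0 : ∀ k, 1 ≤ k → k ≤ r → 0 < M k)
    (hΔ0 : ∀ k, 1 ≤ k → k ≤ r → 0 < Δ k)
    (hbase : c * Δ 1 ≤ M 1)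
    (hstep : ∀ k, 1 ≤ k → k + 1 ≤ r → M k ≤ m * h k ∧
      5 * (m * h k) ≤ M (k+1) ∧ 5 * (c * Δ (k+1)) ≤ M (k+1) ∧
      5 * (m * h k * N * Δ (k+1)) ≤ M (k+1) * Δ k ∧
      5 * (Fintype.card V * h k) ≤ M (k+1)) (k : ℕ) :
    k + 1 ≤ r → ∀ (D : Finset V), D ⊆ D0 → ∀ (C : Finset (Finset V)) (S : Finset V → Finset V),
      C ⊆ Ls → (∀ l ∈ C, S l ⊆ l ∧ S l ⊆ D0 ∧ k + 1 ≤ #(S l)) →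
      (∀ x, #{l ∈ C | x ∈ S l} ≤ Δ (k+1)) → M (k+1) ≤ #C →
      PF z D (fun I => LineFree Ls r I ∧ ∀ l ∈ C, #(I ∩ S l) < k + 1) ≤
        Y * lam ^ (k * m) * (1 + z / lam) ^ #D := by
  have hlam0 : 0 < lam := by linarith
  have hb1 : 1 ≤ 1 + z / lam := by
    have : 0 ≤ z / lam := by positivity
    linarith
  have hfac : ∀ a b : ℕ, Y ≤ Y * lam ^ a * (1 + z / lam) ^ b := by
    intro a b
    have h1 : 1 ≤ lam ^ a := one_le_pow₀ hlam
    have h2 : 1 ≤ (1 + z / lam) ^ b := one_le_pow₀ hb1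
    have h3 : 1 ≤ lam ^ a * (1 + z / lam) ^ b := one_le_mul_of_one_le_of_one_le h1 h2
    rw [mul_assoc]
    exact le_mul_of_one_le_right hY h3
  induction k with
  | zero =>
    intro hr D hD C S hCL hC hdeg hM
    set W := C.biUnion S with hW
    have hWD : W ⊆ D0 := by
      intro x hx
      simp only [hW, mem_biUnion] at hx
      obtain ⟨l, hl, hx⟩ := hx
      exact (hC l hl).2.1 hx
    have hcW : c ≤ #W := by
      have : #C * 1 ≤ #W * Δ 1 := by
        apply Finset.card_mul_le_card_mul (fun l x => x ∈ S l)
        · intro l hl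
          refine (hC l hl).2.2.trans (card_le_card ?_)
          intro x hx
          simp only [bipartiteAbove, mem_filter]
          exact ⟨mem_biUnion.2 ⟨l, hl, hx⟩, hx⟩
        · intro x hx
          exact hdeg x
      have h5 : c * Δ 1 ≤ #W * Δ 1 := by
        have : M 1 ≤ #C := hM
        omega
      exact Nat.le_of_mul_le_mul_right h5 (hΔ0 1 le_rfl hr)
    refine le_trans (PF_mono hz (D' := D0 \ W) (p' := LineFree Ls r) ?_)
      ((hD0 (D0 \ W) ?_).trans (hfac _ _))
    · rintro I hI ⟨h1, h2⟩
      refine ⟨?_, h1⟩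
      intro x hx
      refine mem_sdiff.2 ⟨hD (hI hx), ?_⟩
      intro hxW
      obtain ⟨l, hl, hx'⟩ := mem_biUnion.1 hxW
      have := h2 l hl
      have : I ∩ S l = ∅ := by
        apply card_eq_zero.1; omega
      have h6 : x ∈ I ∩ S l := mem_inter.2 ⟨hx, hx'⟩
      rw [this] at h6
      exact notMem_empty _ h6
    · rw [card_sdiff_of_subset hWD]
      have := card_le_card hWD
      omega
  | succ k ih =>
    intro hr D hD C S hCL hC hdeg hM
    have ihk := ih (by omega)
    obtain ⟨hs0, hs1, hs2, hs3, hs4⟩ := hstep (k+1) (by omega) hr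
    have inner : ∀ d : ℕ, ∀ D : Finset V, #D = d → D ⊆ D0 → ∀ (b : ℕ) (C' : Finset (Finset V))
        (S' : Finset V → Finset V), C' ⊆ C →
        (∀ l ∈ C', S' l ⊆ S l ∧ k + 1 ≤ #(S' l)) →
        (∀ x, #{l ∈ C' | x ∈ S' l} ≤ Δ (k+1)) → #C' + b * h (k+1) = m * h (k+1) →
        PF z D (fun I => LineFree Ls r I ∧ (∀ l ∈ C, #(I ∩ S l) < k + 1 + 1) ∧
          ∀ l ∈ C', #(I ∩ S' l) < k + 1) ≤
        Y * lam ^ (k * m + b) * (1 + z / lam) ^ #D := by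
      intro d
      induction d using Nat.strong_induction_on with
      | _ d ihd =>
      intro D hd hD b C' S' hC' hS' hdeg' hcard
      rcases Nat.eq_zero_or_pos b with hb | hb
      · subst hb
        refine le_trans (PF_mono hz ?_) (ihk D hD C' S' (hC'.trans hCL) ?_ hdeg' ?_)
        · rintro I hI ⟨h1, h2, h3⟩
          exact ⟨hI, h1, h3⟩
        · intro l hl
          obtain ⟨h1, h2⟩ := hS' l hl
          obtain ⟨h3, h4, h5⟩ := hC l (hC' hl)
          exact ⟨h1.trans h3, h1.trans h4, h2⟩
        · omega
      by_cases hcD : #D + c ≤ #D0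
      · refine le_trans (PF_mono hz ?_) ((hD0 D hcD).trans (hfac _ _))
        rintro I hI ⟨h1, h2, h3⟩
        exact ⟨hI, h1⟩
      obtain ⟨v, hvD, hv⟩ := exists_vertex N c m (h (k+1)) (k+1) (M (k+1+1)) (Δ (k+1+1)) (Δ (k+1))
        D0 D hD (by omega) C C' S S' (fun l hl => (hC l hl).2) hdeg hM
        (fun l hl => (card_le_card ((hS' l hl).1.trans (hC l (hC' hl)).1)).trans
          (hLN l (hCL (hC' hl)))) (by omega) (hM0 _ (by omega) hr) (hΔ0 _ (by omega) (by omega))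
        hs1 hs2 hs3 hs4
      obtain ⟨Cv, hCv, hCvh⟩ := exists_subset_card_eq hv
      obtain ⟨b, rfl⟩ : ∃ b', b = b' + 1 := ⟨b - 1, by omega⟩
      have hcardD : #(D.erase v) < d := by
        rw [card_erase_of_mem hvD]
        have := card_pos.2 ⟨v, hvD⟩
        omega
      have hCv' : ∀ l ∈ Cv, l ∈ C ∧ l ∉ C' ∧ v ∈ S l ∧
          k + 1 + 1 ≤ #{x ∈ S l | #{l ∈ C' | x ∈ S' l} < Δ (k+1)} := by
        intro l hl
        have := hCv hl
        simp only [mem_filter, mem_sdiff] at this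
        exact ⟨this.1.1, this.1.2, this.2⟩
      set T : Finset V → Finset V := fun l => if l ∈ Cv then
        {x ∈ S l | #{l ∈ C' | x ∈ S' l} < Δ (k+1)}.erase v else S' l with hT
      have hTv : ∀ l ∈ Cv, T l = {x ∈ S l | #{l ∈ C' | x ∈ S' l} < Δ (k+1)}.erase v := by
        intro l hl; simp only [hT, if_pos hl]
      have hT' : ∀ l ∈ C', T l = S' l := by
        intro l hl
        have : l ∉ Cv := fun h => (hCv' l h).2.1 hl
        simp only [hT, if_neg this]
      have hdisj : Disjoint C' Cv := by
        rw [disjoint_left]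
        intro l hl hl'
        exact (hCv' l hl').2.1 hl
      have A1 := ihd _ hcardD (D.erase v) rfl ((erase_subset _ _).trans hD) (b+1) C' S' hC' hS'
        hdeg' hcard
      have A2 := ihd _ hcardD (D.erase v) rfl ((erase_subset _ _).trans hD) b (C' ∪ Cv) T
        (union_subset hC' (fun l hl => (hCv' l hl).1)) (by
          intro l hl
          rcases mem_union.1 hl with hl | hl
          · rw [hT' l hl]; exact hS' l hl
          · rw [hTv l hl]
            refine ⟨(erase_subset _ _).trans (filter_subset _ _), ?_⟩
            have h1 := (hCv' l hl).2.2.2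
            have h2 := pred_card_le_card_erase (a := v)
              (s := {x ∈ S l | #{l ∈ C' | x ∈ S' l} < Δ (k+1)})
            omega) (by
          intro x
          rw [filter_union]
          refine (card_union_le _ _).trans ?_
          have h1 : #{l ∈ C' | x ∈ T l} = #{l ∈ C' | x ∈ S' l} := by
            congr 1
            apply filter_congr
            intro l hl
            rw [hT' l hl]
          rw [h1]
          by_cases hx : #{l ∈ C' | x ∈ S' l} < Δ (k+1)
          · have : #{l ∈ Cv | x ∈ T l} ≤ 1 := by
              rw [card_le_one]
              intro l hl l' hl'
              simp only [mem_filter] at hl hl'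
              have e1 := hl.2
              have e2 := hl'.2
              rw [hTv l hl.1] at e1
              rw [hTv l' hl'.1] at e2
              simp only [mem_erase, mem_filter] at e1 e2
              have f1 := hCv' l hl.1
              have f2 := hCv' l' hl'.1
              exact hlin l (hCL f1.1) l' (hCL f2.1) x v e1.1 ((hC l f1.1).1 e1.2.1)
                ((hC l' f2.1).1 e2.2.1) ((hC l f1.1).1 f1.2.2.1) ((hC l' f2.1).1 f2.2.2.1)
            omega
          · have : #{l ∈ Cv | x ∈ T l} = 0 := by
              rw [card_eq_zero, filter_eq_empty_iff]
              intro l hl hxl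
              rw [hTv l hl] at hxl
              simp only [mem_erase, mem_filter] at hxl
              exact hx hxl.2.2
            have := hdeg' x
            omega) (by
          rw [card_union_of_disjoint hdisj, hCvh, ← hcard]
          ring)
      rw [PF_split z D _ v hvD]
      have B2 : PF z (D.erase v) (fun I => LineFree Ls r (insert v I) ∧
          (∀ l ∈ C, #(insert v I ∩ S l) < k + 1 + 1) ∧ ∀ l ∈ C', #(insert v I ∩ S' l) < k + 1) ≤
          Y * lam ^ (k * m + b) * (1 + z / lam) ^ #(D.erase v) := by
        refine le_trans (PF_mono hz ?_) A2
        rintro I hI ⟨h1, h2, h3⟩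
        refine ⟨hI, h1.mono (subset_insert _ _), ?_, ?_⟩
        · intro l hl
          exact lt_of_le_of_lt (card_le_card (inter_subset_inter_right (subset_insert _ _)))
            (h2 l hl)
        · intro l hl
          rcases mem_union.1 hl with hl | hl
          · rw [hT' l hl]
            exact lt_of_le_of_lt (card_le_card (inter_subset_inter_right (subset_insert _ _)))
              (h3 l hl)
          · have f := hCv' l hl
            have g := h2 l f.1
            have : insert v (I ∩ T l) ⊆ insert v I ∩ S l := by
              intro x hx
              rw [hTv l hl] at hx
              simp only [mem_insert, mem_inter, mem_erase, mem_filter] at hx ⊢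
              rcases hx with rfl | hx
              · exact ⟨Or.inl rfl, f.2.2.1⟩
              · exact ⟨Or.inr hx.1, hx.2.2.1⟩
            have g2 := card_le_card this
            rw [card_insert_of_notMem] at g2
            · omega
            · intro hvI
              exact notMem_erase v D (hI (mem_inter.1 hvI).1)
      have hDc : #D = #(D.erase v) + 1 := by
        rw [card_erase_of_mem hvD]
        have := card_pos.2 ⟨v, hvD⟩
        omega
      calc _ ≤ Y * lam ^ (k * m + (b + 1)) * (1 + z / lam) ^ #(D.erase v) +
            z * (Y * lam ^ (k * m + b) * (1 + z / lam) ^ #(D.erase v)) := by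
            gcongr
        _ = _ := by
          rw [hDc, pow_succ (1 + z / lam), ← add_assoc, pow_succ lam]
          field_simp
          
    have := inner _ D rfl hD m ∅ (fun _ => ∅) (by simp) (by simp) (by simp) (by simp)
    refine le_trans (PF_mono hz ?_) (this.trans (le_of_eq ?_))
    · rintro I hI ⟨h1, h2⟩
      exact ⟨hI, h1, h2, by simp⟩
    · congr 3
      ring


/-- Double counting of incidences. -/
theorem incidence_count {V : Type} [DecidableEq V] (Ls : Finset (Finset V))
    (sd : ℕ) (hdeg : ∀ x, #{l ∈ Ls | x ∈ l} = sd) (D : Finset V) :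
    ∑ l ∈ Ls, #(D ∩ l) = #D * sd := by
  have hb := sum_card_bipartiteAbove_eq_sum_card_bipartiteBelow (s := D) (t := Ls)
        (fun x l => x ∈ l)
  rw [← smul_eq_mul, ← sum_const, ← sum_congr rfl (fun x _ => hdeg x)]
  refine Eq.trans ?_ hb.symm
  apply sum_congr rfl
  intro l hl
  congr 1

theorem PF_bound {V : Type} [DecidableEq V] [Fintype V]
    (Ls : Finset (Finset V)) (r w E sd : ℕ) (z lam : ℝ) (hr : 5 ≤ r) (hw : 3 * r + 1 ≤ w)
    (hz : 0 ≤ z) (hlam : 1 ≤ lam)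
    (hLN : ∀ l ∈ Ls, #l = r ^ 2)
    (hlin : ∀ l ∈ Ls, ∀ l' ∈ Ls, ∀ x y, x ≠ y → x ∈ l → x ∈ l' → y ∈ l → y ∈ l' → l = l')
    (hdeg : ∀ x, #{l ∈ Ls | x ∈ l} = sd) (hsd : sd = r ^ (w * (r - 1)))
    (hn : Fintype.card V = r ^ (E + 3 * r + w + 2)) :
    PF z univ (LineFree Ls r) ≤ (1 + z) ^ (2 * r ^ (E + 3 * r + w + 1)) *
      (lam ^ ((r - 1) * r ^ (E + 3 * r)) * (1 + z / lam) ^ (Fintype.card V)) ^ (r ^ (3 * r)) := by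
  have hlam0 : 0 < lam := by linarith
  have hr0 : 0 < r := by omega
  set F : ℝ := lam ^ ((r - 1) * r ^ (E + 3 * r)) * (1 + z / lam) ^ (Fintype.card V) with hF
  set q := 2 * r ^ (E + 3 * r + w + 1) with hq
  set c := r ^ (E + w + 2) with hc
  have hb1 : 1 ≤ 1 + z / lam := by
    have : 0 ≤ z / lam := by positivity
    linarith
  have hF1 : 1 ≤ F := one_le_mul_of_one_le_of_one_le (one_le_pow₀ hlam) (one_le_pow₀ hb1)
  have key : ∀ j : ℕ, ∀ D : Finset V, #D ≤ q + j * c →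
      PF z D (LineFree Ls r) ≤ (1 + z) ^ q * F ^ j := by
    intro j
    induction j with
    | zero =>
      intro D hD
      simp only [zero_mul, add_zero, pow_zero, mul_one] at hD ⊢
      exact (PF_le hz D _).trans (pow_le_pow_right₀ (by linarith) hD)
    | succ j ih =>
      intro D hD
      by_cases hDq : #D ≤ q
      · refine (PF_le hz D _).trans ((pow_le_pow_right₀ (by linarith) hDq).trans ?_)
        exact le_mul_of_one_le_right (by positivity) (one_le_pow₀ hF1)
      have hcore := core Ls (r ^ 2) r c (r ^ (E + 3 * r)) (fun k => r ^ (E + w * k + 3 * k - 1))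
        (fun k => r ^ (w * (k - 1))) (fun k => r ^ (w * k + 3 * k - 3 * r - 1)) z lam
        ((1 + z) ^ q * F ^ j) hz hlam (by positivity) (fun l hl => (hLN l hl).le) hlin D
        (by
          intro D' hD'
          apply ih
          rw [add_mul, one_mul] at hD
          omega) (fun k _ _ => by positivity) (fun k _ _ => by positivity)
        (by
          simp only [hc, mul_one, Nat.sub_self, mul_zero, pow_zero]
          apply le_of_eq; congr 1) (by
          intro k hk1 hk2
          obtain ⟨k, rfl⟩ : ∃ k', k = k' + 1 := ⟨k - 1, by omega⟩
          obtain ⟨w', rfl⟩ : ∃ w', w = 3 * r + 1 + w' := ⟨w - (3 * r + 1), by omega⟩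
          simp only [Nat.add_sub_cancel]
          set w := 3 * r + 1 + w' with hw'
          have e1 : w * (k + 1) + 3 * (k + 1) - 3 * r - 1 = w' + w * k + 3 * (k+1) := by
            rw [mul_add w]; omega
          have e2 : E + w * (k + 1) + 3 * (k + 1) - 1 = E + w * k + w + 3 * k + 2 := by
            rw [mul_add w]; omega
          have e3 : E + w * (k + 1 + 1) + 3 * (k + 1 + 1) - 1
            = E + w * k + w + w + 3 * k + 5 := by
            rw [mul_add w, mul_add w]; omega
          have e4 : w * (k + 1) = w * k + w := by ring
          rw [e1, e2, e3, e4, hn]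
          set u := w * k with hu
          have e5 : r ^ (E + 3 * r) * r ^ (w' + u + 3 * (k + 1)) = r ^ (E + u + w + 3 * k + 2) := by
            rw [← pow_add]; congr 1; omega
          have mon : ∀ a b : ℕ, a + 1 ≤ b → 5 * r ^ a ≤ r ^ b := by
            intro a b hab
            calc 5 * r ^ a ≤ r * r ^ a := Nat.mul_le_mul_right _ hr
              _ = r ^ (a + 1) := by ring
              _ ≤ r ^ b := Nat.pow_le_pow_right hr0 hab
          refine ⟨e5.ge, ?_, ?_, ?_, ?_⟩
          · rw [e5]; apply mon; omega
          · rw [hc, ← pow_add]; apply mon; omega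
          · rw [e5, ← pow_add, ← pow_add, ← pow_add]; apply mon; omega
          · rw [← pow_add]; apply mon; omega) (r - 1)
      have hr1 : r - 1 + 1 = r := by omega
      simp only [hr1] at hcore
      have hinc := incidence_count Ls sd hdeg
      have hC0 : r ^ (E + w * r + 3 * r - 1) ≤ #{l ∈ Ls | r ≤ #(D ∩ l)} := by
        have i1 : #Ls * r ^ 2 = Fintype.card V * sd := by
          have := hinc univ
          rw [card_univ, sum_congr rfl (fun l hl => by rw [univ_inter, hLN l hl]), sum_const,
            smul_eq_mul] at this
          exact this
        have i2 : #D * sd ≤ #{l ∈ Ls | r ≤ #(D ∩ l)} * r ^ 2 + #Ls * r := by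
          rw [← hinc D, ← sum_filter_add_sum_filter_not Ls (fun l => r ≤ #(D ∩ l))]
          apply add_le_add
          · rw [← smul_eq_mul]
            apply sum_le_card_nsmul
            intro l hl
            rw [← hLN l (mem_filter.1 hl).1]
            exact card_le_card inter_subset_right
          · refine le_trans (sum_le_card_nsmul _ _ r ?_) ?_
            · intro l hl
              have := (mem_filter.1 hl).2
              omega
            · rw [smul_eq_mul]
              exact Nat.mul_le_mul_right _ (card_le_card (filter_subset _ _))
        set A := #{l ∈ Ls | r ≤ #(D ∩ l)}
        have i3 : q * r = 2 * Fintype.card V := by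
          rw [hn, hq]; ring
        have i4 : 2 * Fintype.card V * sd ≤ A * r ^ 3 + Fintype.card V * sd := by
          calc 2 * Fintype.card V * sd = q * sd * r := by rw [← i3]; ring
            _ ≤ #D * sd * r := by
              apply Nat.mul_le_mul_right; apply Nat.mul_le_mul_right; omega
            _ ≤ (A * r ^ 2 + #Ls * r) * r := Nat.mul_le_mul_right _ i2
            _ = A * r ^ 3 + #Ls * r ^ 2 := by ring
            _ = _ := by rw [i1]
        have i5 : r ^ (E + w * r + 3 * r - 1) * r ^ 3 = Fintype.card V * sd := by
          rw [hn, hsd, ← pow_add, ← pow_add]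
          congr 1
          obtain ⟨r', rfl⟩ : ∃ r', r = r' + 1 := ⟨r - 1, by omega⟩
          rw [Nat.add_sub_cancel, mul_add w]
          omega
        have i6 : r ^ (E + w * r + 3 * r - 1) * r ^ 3 ≤ A * r ^ 3 := by
          rw [i5]
          have : 2 * Fintype.card V * sd = Fintype.card V * sd + Fintype.card V * sd := by ring
          omega
        exact Nat.le_of_mul_le_mul_right i6 (by positivity)
      have := hcore le_rfl D (Finset.Subset.refl _) {l ∈ Ls | r ≤ #(D ∩ l)} (fun l => D ∩ l)
        (filter_subset _ _)
        (fun l hl => ⟨inter_subset_right, inter_subset_left, (mem_filter.1 hl).2⟩)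
        (by
          intro x
          rw [← hsd, ← hdeg x]
          apply card_le_card
          intro l hl
          simp only [mem_filter, mem_inter] at hl ⊢
          exact ⟨hl.1.1, hl.2.2⟩) hC0
      refine le_trans (PF_mono hz ?_) (this.trans ?_)
      · intro I hI hf
        refine ⟨hI, hf, ?_⟩
        intro l hl
        refine lt_of_le_of_lt (card_le_card ?_) (hf l (mem_filter.1 hl).1)
        exact inter_subset_inter_left inter_subset_right
      · rw [pow_succ, ← mul_assoc, hF, ← mul_assoc]
        gcongr
        exact card_le_univ D
  apply key
  rw [card_univ, hn, hc, ← pow_add]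
  have : 3 * r + (E + w + 2) = E + 3 * r + w + 2 := by ring
  rw [this]
  omega


theorem fm_total {V : Type} [DecidableEq V] [Fintype V] (z : ℝ) :
    ∑ X : Finset V, z ^ #X = (1 + z) ^ Fintype.card V := by
  have := Finset.sum_pow_mul_eq_add_pow z 1 (univ : Finset V)
  simpa [add_comm] using this

theorem fm_super {V : Type} [DecidableEq V] [Fintype V] (z : ℝ) (hz : 0 ≤ z) (A : Finset V) :
    ∑ X : Finset V, (if A ⊆ X then z ^ #X else 0) ≤ z ^ #A * (1 + z) ^ Fintype.card V := by
  rw [← fm_total, ← sum_filter]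
  have h1 : ∑ X ∈ (univ : Finset (Finset V)) with A ⊆ X, z ^ #X =
      z ^ #A * ∑ Y ∈ ({X ∈ (univ : Finset (Finset V)) | A ⊆ X}).image (fun X => X \ A), z ^ #Y := by
    rw [sum_image, mul_sum]
    · apply sum_congr rfl
      intro X hX
      rw [← pow_add, ← card_sdiff_add_card_eq_card (mem_filter.1 hX).2, add_comm]
    · intro X hX Y hY hXY
      simp only [coe_filter, mem_univ, true_and, Set.mem_ofPred_eq] at hX hY hXY
      rw [← sdiff_union_of_subset hX, hXY, sdiff_union_of_subset hY]
  rw [h1]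
  gcongr
  exact subset_univ _

theorem fm_family {V : Type} [DecidableEq V] [Fintype V] (z : ℝ) (hz : 0 ≤ z)
    (F : Finset (Finset V)) :
    ∑ X : Finset V, z ^ #X * (#{A ∈ F | A ⊆ X} : ℝ) ≤
      (∑ A ∈ F, z ^ #A) * (1 + z) ^ Fintype.card V := by
  rw [sum_mul]
  calc ∑ X : Finset V, z ^ #X * (#{A ∈ F | A ⊆ X} : ℝ)
      = ∑ X : Finset V, ∑ A ∈ F, (if A ⊆ X then z ^ #X else 0) := by
        apply sum_congr rfl
        intro X _
        rw [← sum_filter, sum_const, nsmul_eq_mul, mul_comm]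
    _ = ∑ A ∈ F, ∑ X : Finset V, (if A ⊆ X then z ^ #X else 0) := sum_comm
    _ ≤ _ := sum_le_sum (fun A _ => fm_super z hz A)

theorem fm_small {V : Type} [DecidableEq V] [Fintype V] (z : ℝ) (hz : 0 ≤ z) (t : ℕ) :
    ∑ X : Finset V, z ^ #X * (if #X < t then 1 else 0) ≤
      2 ^ t * (1 + z / 2) ^ Fintype.card V := by
  rw [← fm_total, mul_sum]
  apply sum_le_sum
  intro X _
  split_ifs with h
  · rw [div_pow, mul_one, mul_div_assoc', le_div_iff₀ (by positivity), mul_comm]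
    gcongr
    norm_num
  · simp; positivity

theorem fm_exists {V : Type} [DecidableEq V] [Fintype V] (z : ℝ) (hz : 0 ≤ z) (t : ℕ)
    (F1 F2 F3 : Finset (Finset V)) (a1 a2 : ℝ) (h1 : 0 ≤ a1) (h2 : 0 ≤ a2)
    (H0 : 2 ^ t * (1 + z / 2) ^ Fintype.card V ≤ 1 / 5 * (1 + z) ^ Fintype.card V)
    (H1 : a1 * ∑ A ∈ F1, z ^ #A ≤ 1 / 5) (H2 : a2 * ∑ A ∈ F2, z ^ #A ≤ 1 / 5)
    (H3 : ∑ A ∈ F3, z ^ #A ≤ 1 / 5) :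
    ∃ X : Finset V, t ≤ #X ∧ a1 * #{A ∈ F1 | A ⊆ X} ≤ 1 ∧ a2 * #{A ∈ F2 | A ⊆ X} ≤ 1 ∧
      ∀ A ∈ F3, ¬ A ⊆ X := by
  set W : ℝ := (1 + z) ^ Fintype.card V with hW
  have hWpos : 0 < W := by positivity
  have key : ∑ X : Finset V, z ^ #X * ((if #X < t then 1 else 0) + a1 * #{A ∈ F1 | A ⊆ X} +
      a2 * #{A ∈ F2 | A ⊆ X} + #{A ∈ F3 | A ⊆ X}) < ∑ X : Finset V, z ^ #X * 1 := by
    have e : ∑ X : Finset V, z ^ #X * ((if #X < t then 1 else 0) + a1 * #{A ∈ F1 | A ⊆ X} +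
      a2 * #{A ∈ F2 | A ⊆ X} + #{A ∈ F3 | A ⊆ X}) =
      ∑ X : Finset V, z ^ #X * (if #X < t then 1 else 0) +
      a1 * ∑ X : Finset V, z ^ #X * (#{A ∈ F1 | A ⊆ X} : ℝ) +
      a2 * ∑ X : Finset V, z ^ #X * (#{A ∈ F2 | A ⊆ X} : ℝ) +
      ∑ X : Finset V, z ^ #X * (#{A ∈ F3 | A ⊆ X} : ℝ) := by
      rw [mul_sum, mul_sum, ← sum_add_distrib, ← sum_add_distrib, ← sum_add_distrib]
      apply sum_congr rfl
      intro X _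
      ring
    rw [e]
    simp only [mul_one]
    rw [fm_total]
    have b0 := (fm_small (V := V) z hz t).trans H0
    have b1 := mul_le_mul_of_nonneg_left (fm_family z hz F1) h1
    have b2 := mul_le_mul_of_nonneg_left (fm_family z hz F2) h2
    have b3 := fm_family z hz F3
    rw [← mul_assoc] at b1 b2
    have c1 := mul_le_mul_of_nonneg_right H1 hWpos.le
    have c2 := mul_le_mul_of_nonneg_right H2 hWpos.le
    have c3 := mul_le_mul_of_nonneg_right H3 hWpos.le
    linarith
  obtain ⟨X, -, hX⟩ := exists_lt_of_sum_lt key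
  have hX' := lt_of_mul_lt_mul_left hX (by positivity)
  have p0 : (0 : ℝ) ≤ (if #X < t then 1 else 0) := by split_ifs <;> norm_num
  have p1 : 0 ≤ a1 * #{A ∈ F1 | A ⊆ X} := by positivity
  have p2 : 0 ≤ a2 * #{A ∈ F2 | A ⊆ X} := by positivity
  have p3 : (0 : ℝ) ≤ #{A ∈ F3 | A ⊆ X} := by positivity
  refine ⟨X, ?_, by linarith, by linarith, ?_⟩
  · by_contra hcon
    rw [if_pos (by omega)] at hX'
    linarith
  · intro A hA hAX
    have : 0 < #{A ∈ F3 | A ⊆ X} := card_pos.2 ⟨A, mem_filter.2 ⟨hA, hAX⟩⟩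
    have : (1 : ℝ) ≤ #{A ∈ F3 | A ⊆ X} := by exact_mod_cast this
    linarith

/-- The deterministic clean-up. -/
theorem cleanup {V : Type} [DecidableEq V] [Fintype V] (Ls : Finset (Finset V)) (r μ Dg : ℕ)
    (X : Finset V) (hX : μ ≤ 4 * #X)
    (h1 : 40 * #{A ∈ {A ∈ (univ : Finset (Finset V)) | #A = r + 1 ∧ ∃ l ∈ Ls, A ⊆ l} | A ⊆ X} ≤ μ)
    (h2 : 40 * r * #{A ∈ {A ∈ (univ : Finset (Finset V)) | #A = r ∧ ∃ l ∈ Ls, A ⊆ l} | A ⊆ X}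
      ≤ Dg * μ) (hDg : 0 < Dg)
    (h3 : ∀ I, I ⊆ X → μ ≤ 10 * #I → ¬ LineFree Ls r I) :
    ∃ X' : Finset V,
      (∀ x ∈ X', #{y ∈ X' | y ≠ x ∧ ∃ l ∈ Ls, r ≤ #(X' ∩ l) ∧ x ∈ l ∧ y ∈ l} ≤ Dg * r) ∧
      ∀ S, S ⊆ X' → ∃ l ∈ Ls, r ≤ #(X' ∩ l) ∧ (X' ∩ l ⊆ S ∨ Disjoint (X' ∩ l) S) := by
  set B1 := {A ∈ {A ∈ (univ : Finset (Finset V)) | #A = r + 1 ∧ ∃ l ∈ Ls, A ⊆ l} | A ⊆ X} with hB1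
  set B2 := {A ∈ {A ∈ (univ : Finset (Finset V)) | #A = r ∧ ∃ l ∈ Ls, A ⊆ l} | A ⊆ X} with hB2
  have hne : ∀ A : Finset V, ∃ Y : Finset V, #Y ≤ 1 ∧ (A ∈ B1 → ∃ x ∈ A, x ∈ Y) := by
    intro A
    by_cases hA : A ∈ B1
    · have : #A = r + 1 := by
        simp only [hB1, mem_filter] at hA; exact hA.1.2.1
      obtain ⟨x, hx⟩ := card_pos.1 (by omega : 0 < #A)
      exact ⟨{x}, by simp, fun _ => ⟨x, hx, by simp⟩⟩
    · exact ⟨∅, by simp, fun h => absurd h hA⟩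
  choose f hf1 hf2 using hne
  set Y1 := B1.biUnion f with hY1
  set Y2 := {x ∈ X | Dg < #{A ∈ B2 | x ∈ A}} with hY2
  have c1 : #Y1 ≤ #B1 := by
    have := card_biUnion_le_card_mul B1 f 1 (fun A _ => hf1 A)
    simpa using this
  have c2 : #Y2 * Dg ≤ #B2 * r := by
    apply Finset.card_mul_le_card_mul (fun x A => x ∈ A)
    · intro x hx
      have := (mem_filter.1 hx).2
      exact this.le
    · intro A hA
      simp only [hB2, mem_filter] at hA
      rw [← hA.1.2.1]
      apply card_le_card
      intro x hx
      exact (mem_filter.1 hx).2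
  have c3 : 40 * #Y2 ≤ μ := by
    have : 40 * #Y2 * Dg ≤ μ * Dg := by
      calc 40 * #Y2 * Dg = 40 * (#Y2 * Dg) := by ring
        _ ≤ 40 * (#B2 * r) := Nat.mul_le_mul_left _ c2
        _ = 40 * r * #B2 := by ring
        _ ≤ _ := h2
        _ = _ := mul_comm _ _
    exact Nat.le_of_mul_le_mul_right this hDg
  set X' := X \ (Y1 ∪ Y2) with hX'
  have hX'X : X' ⊆ X := sdiff_subset
  have c4 : #X ≤ #X' + #Y1 + #Y2 := by
    have h6 := le_card_sdiff (Y1 ∪ Y2) X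
    rw [← hX'] at h6
    have := card_union_le Y1 Y2
    omega
  have hexact : ∀ l ∈ Ls, #(X' ∩ l) ≤ r := by
    intro l hl
    by_contra! hcon
    obtain ⟨A, hA, hAc⟩ := exists_subset_card_eq (show r + 1 ≤ #(X' ∩ l) from hcon)
    have hAB : A ∈ B1 := by
      simp only [hB1, mem_filter, mem_univ, true_and]
      exact ⟨⟨hAc, l, hl, hA.trans inter_subset_right⟩,
        (hA.trans inter_subset_left).trans hX'X⟩
    obtain ⟨x, hx, hxf⟩ := hf2 A hAB
    have hxX' : x ∈ X' := (mem_inter.1 (hA hx)).1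
    rw [hX', mem_sdiff, mem_union] at hxX'
    exact hxX'.2 (Or.inl (mem_biUnion.2 ⟨A, hAB, hxf⟩))
  refine ⟨X', ?_, ?_⟩
  · intro x hx
    have hxd : #{A ∈ B2 | x ∈ A} ≤ Dg := by
      by_contra! hcon
      have h5 := hx
      rw [hX', mem_sdiff, mem_union] at h5
      exact h5.2 (Or.inr (mem_filter.2 ⟨hX'X hx, hcon⟩))
    have : {y ∈ X' | y ≠ x ∧ ∃ l ∈ Ls, r ≤ #(X' ∩ l) ∧ x ∈ l ∧ y ∈ l} ⊆
        ({A ∈ B2 | x ∈ A}).biUnion id := by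
      intro y hy
      obtain ⟨hyX, hyx, l, hl, hlr, hxl, hyl⟩ := mem_filter.1 hy
      refine mem_biUnion.2 ⟨X' ∩ l, ?_, mem_inter.2 ⟨hyX, hyl⟩⟩
      simp only [hB2, mem_filter, mem_univ, true_and]
      exact ⟨⟨⟨le_antisymm (hexact l hl) hlr, l, hl, inter_subset_right⟩,
        inter_subset_left.trans hX'X⟩, mem_inter.2 ⟨hx, hxl⟩⟩
    refine (card_le_card this).trans ((card_biUnion_le_card_mul _ _ r ?_).trans
      (Nat.mul_le_mul_right _ hxd))
    intro A hA
    simp only [hB2, mem_filter] at hA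
    exact hA.1.1.2.1.le
  · intro S hS
    have hcS : #(X' \ S) = #X' - #S := card_sdiff_of_subset hS
    have hcS' := card_le_card hS
    by_cases hbig : μ ≤ 10 * #S
    · have := h3 S (hS.trans hX'X) hbig
      unfold LineFree at this
      push Not at this
      obtain ⟨l, hl, hlr⟩ := this
      have hsub : S ∩ l ⊆ X' ∩ l := inter_subset_inter_right hS
      have heq : S ∩ l = X' ∩ l := eq_of_subset_of_card_le hsub ((hexact l hl).trans hlr)
      refine ⟨l, hl, heq ▸ hlr, Or.inl ?_⟩
      rw [← heq]; exact inter_subset_left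
    · have := h3 (X' \ S) (sdiff_subset.trans hX'X) (by omega)
      unfold LineFree at this
      push Not at this
      obtain ⟨l, hl, hlr⟩ := this
      have hsub : (X' \ S) ∩ l ⊆ X' ∩ l := inter_subset_inter_right sdiff_subset
      have heq : (X' \ S) ∩ l = X' ∩ l := eq_of_subset_of_card_le hsub ((hexact l hl).trans hlr)
      refine ⟨l, hl, heq ▸ hlr, Or.inr ?_⟩
      rw [← heq]
      exact disjoint_of_subset_left inter_subset_left sdiff_disjoint


theorem count_coll {V : Type} [DecidableEq V] [Fintype V] (Ls : Finset (Finset V)) (N k : ℕ)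
    (hLN : ∀ l ∈ Ls, #l = N) :
    #{A ∈ (univ : Finset (Finset V)) | #A = k ∧ ∃ l ∈ Ls, A ⊆ l} ≤ #Ls * N ^ k := by
  have : {A ∈ (univ : Finset (Finset V)) | #A = k ∧ ∃ l ∈ Ls, A ⊆ l} ⊆
      Ls.biUnion (fun l => powersetCard k l) := by
    intro A hA
    simp only [mem_filter, mem_univ, true_and] at hA
    obtain ⟨hk, l, hl, hAl⟩ := hA
    exact mem_biUnion.2 ⟨l, hl, mem_powersetCard.2 ⟨hAl, hk⟩⟩
  refine (card_le_card this).trans (card_biUnion_le_card_mul _ _ _ ?_)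
  intro l hl
  rw [card_powersetCard, hLN l hl]
  exact Nat.choose_le_pow N k

/-- numeric bound on the partition function. -/
theorem PF_numeric (r w E q k0 n μ : ℕ) (z : ℝ) (hr : 1000 ≤ r) (hq : q = 3 * r + 4)
    (hk0 : 0 < k0) (hz : z = 1 / k0) (hμ : μ = r ^ (E + 3 * r + q)) (hn : n = μ * k0)
    (hn' : n = r ^ (E + 3 * r + w + 2)) :
    (1 + 3 * z) ^ (2 * r ^ (E + 3 * r + w + 1)) *
      (((r : ℝ) ^ (3 * r + 1)) ^ ((r - 1) * r ^ (E + 3 * r)) *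
        (1 + 3 * z / ((r : ℝ) ^ (3 * r + 1))) ^ n) ^ (r ^ (3 * r)) ≤
    Real.exp (13 * μ / r) := by
  have hrR : (0 : ℝ) < r := by
    have : 0 < r := by omega
    exact_mod_cast this
  have hk0R : (0 : ℝ) < k0 := by exact_mod_cast hk0
  have hz0 : 0 < z := by rw [hz]; positivity
  have hzn : z * n = μ := by
    rw [hz, hn]; push_cast; field_simp
  have one_add : ∀ (x : ℝ) (a : ℕ), 0 ≤ x → (1 + x) ^ a ≤ Real.exp (x * a) := by
    intro x a hx
    rw [mul_comm, Real.exp_nat_mul]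
    gcongr
    linarith [Real.add_one_le_exp x]
  have t1 : (1 + 3 * z) ^ (2 * r ^ (E + 3 * r + w + 1)) ≤ Real.exp (6 * μ / r) := by
    refine (one_add _ _ (by positivity)).trans (Real.exp_le_exp.2 (le_of_eq ?_))
    rw [← hzn, hn']
    push_cast
    rw [pow_succ (r : ℝ) (E + 3 * r + w + 1)]
    field_simp
    norm_num
  have t2 : (r : ℝ) ^ (3 * r + 1) ≤ Real.exp (4 * r ^ 2) := by
    have h1 : (r : ℝ) ≤ Real.exp r := by linarith [Real.add_one_le_exp (r : ℝ)]
    calc (r : ℝ) ^ (3 * r + 1) ≤ Real.exp r ^ (3 * r + 1) := by gcongr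
      _ = Real.exp ((3 * r + 1) * r) := by
        rw [← Real.exp_nat_mul]; push_cast; ring_nf
      _ ≤ _ := by
        apply Real.exp_le_exp.2
        have : (1000 : ℝ) ≤ r := by exact_mod_cast hr
        nlinarith
  have t3 : ((r : ℝ) ^ (3 * r + 1)) ^ ((r - 1) * r ^ (E + 3 * r)) ≤
      Real.exp (4 * r ^ 2 * (r * r ^ (E + 3 * r))) := by
    have h1 : (1 : ℝ) ≤ (r : ℝ) ^ (3 * r + 1) := one_le_pow₀ (by exact_mod_cast (by omega : 1 ≤ r))
    calc ((r : ℝ) ^ (3 * r + 1)) ^ ((r - 1) * r ^ (E + 3 * r))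
        ≤ ((r : ℝ) ^ (3 * r + 1)) ^ (r * r ^ (E + 3 * r)) := by
          apply pow_le_pow_right₀ h1
          exact Nat.mul_le_mul_right _ (by omega)
      _ ≤ (Real.exp (4 * r ^ 2)) ^ (r * r ^ (E + 3 * r)) := by gcongr
      _ = _ := by
        rw [← Real.exp_nat_mul]; push_cast; ring_nf
  have t4 : (1 + 3 * z / ((r : ℝ) ^ (3 * r + 1))) ^ n ≤ Real.exp (3 * μ / r ^ (3 * r + 1)) := by
    refine (one_add _ _ (by positivity)).trans (Real.exp_le_exp.2 (le_of_eq ?_))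
    rw [← hzn]
    ring
  have t5 : (((r : ℝ) ^ (3 * r + 1)) ^ ((r - 1) * r ^ (E + 3 * r)) *
        (1 + 3 * z / ((r : ℝ) ^ (3 * r + 1))) ^ n) ^ (r ^ (3 * r)) ≤ Real.exp (7 * μ / r) := by
    calc _ ≤ (Real.exp (4 * r ^ 2 * (r * r ^ (E + 3 * r))) *
          Real.exp (3 * μ / r ^ (3 * r + 1))) ^ (r ^ (3 * r)) := by gcongr
      _ = Real.exp (7 * μ / r) := by
        rw [← Real.exp_add, ← Real.exp_nat_mul]
        congr 1
        have e1 : (μ : ℝ) = r ^ (E + 3 * r) * r ^ (3 * r) * r ^ 4 := by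
          rw [hμ, hq]; push_cast; rw [← pow_add, ← pow_add]; congr 1
        rw [e1]
        push_cast
        rw [pow_succ (r : ℝ) (3 * r)]
        field_simp
        ring
  calc _ ≤ Real.exp (6 * μ / r) * Real.exp (7 * μ / r) := by gcongr
    _ = _ := by rw [← Real.exp_add]; congr 1; ring

theorem small_numeric (n μ k0 : ℕ) (z : ℝ) (hk0 : 0 < k0) (hz : z = 1 / k0) (hn : n = μ * k0)
    (hμ : 20000 ≤ μ) :
    2 ^ (μ / 4 + 1) * (1 + z / 2) ^ n ≤ 1 / 5 * (1 + z) ^ n := by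
  have hk0R : (1 : ℝ) ≤ k0 := by exact_mod_cast hk0
  have hz0 : 0 < z := by rw [hz]; positivity
  have hz1 : z ≤ 1 := by rw [hz, div_le_one (by linarith)]; exact hk0R
  have h1 : (1 + z / 2) * (1 + z / 3) ≤ 1 + z := by nlinarith
  have h2 : (4 / 3 : ℝ) ≤ (1 + z / 3) ^ k0 := by
    have := one_add_mul_le_pow (a := z / 3) (by linarith) k0
    refine le_trans (le_of_eq ?_) this
    rw [hz]; field_simp; norm_num
  have h3 : (4 / 3 : ℝ) ^ μ ≤ (1 + z / 3) ^ n := by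
    rw [hn, mul_comm, pow_mul]; gcongr
  have h4 : (5 * 2 ^ (μ / 4 + 1) : ℝ) ≤ (4 / 3 : ℝ) ^ μ := by
    have e1 : (10000 : ℝ) ≤ (3 / 2) ^ μ := by
      have := one_add_mul_le_pow (a := (1 / 2 : ℝ)) (by norm_num) μ
      have h5 : (20000 : ℝ) ≤ μ := by exact_mod_cast hμ
      norm_num at this ⊢
      linarith
    have e2 : ((5 * 2 ^ (μ / 4 + 1) : ℝ)) ^ 4 ≤ ((4 / 3 : ℝ) ^ μ) ^ 4 := by
      calc ((5 * 2 ^ (μ / 4 + 1) : ℝ)) ^ 4 = 625 * 2 ^ (4 * (μ / 4 + 1)) := by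
            rw [mul_pow, ← pow_mul, mul_comm (μ / 4 + 1) 4]; norm_num
        _ ≤ 625 * 2 ^ (μ + 4) := by
            gcongr
            · norm_num
            · omega
        _ = 10000 * 2 ^ μ := by rw [pow_add]; ring
        _ ≤ (3 / 2) ^ μ * 2 ^ μ := by gcongr
        _ = 3 ^ μ := by rw [← mul_pow]; norm_num
        _ ≤ ((4 / 3 : ℝ) ^ 4) ^ μ := by gcongr; norm_num
        _ = _ := by rw [← pow_mul, ← pow_mul, mul_comm]
    exact le_of_pow_le_pow_left₀ (by norm_num) (by positivity) e2
  have h5 : (1 + z / 2) ^ n * (1 + z / 3) ^ n ≤ (1 + z) ^ n := by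
    rw [← mul_pow]; gcongr
  have h6 : (5 * 2 ^ (μ / 4 + 1) : ℝ) * (1 + z / 2) ^ n ≤ (1 + z) ^ n := by
    refine le_trans ?_ h5
    rw [mul_comm]
    gcongr
    exact h4.trans h3
  linarith

theorem abstract_exists {V : Type} [DecidableEq V] [Fintype V]
    (Ls : Finset (Finset V)) (r q w E sd : ℕ) (hr : 1000 ≤ r) (hq : q = 3 * r + 4)
    (hw : w = q * (r + 1))
    (hLN : ∀ l ∈ Ls, #l = r ^ 2)
    (hlin : ∀ l ∈ Ls, ∀ l' ∈ Ls, ∀ x y, x ≠ y → x ∈ l → x ∈ l' → y ∈ l → y ∈ l' → l = l')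
    (hdeg : ∀ x, #{l ∈ Ls | x ∈ l} = sd) (hsd : sd = r ^ (w * (r - 1)))
    (hn : Fintype.card V = r ^ (E + 3 * r + w + 2)) :
    ∃ X' : Finset V,
      (∀ x ∈ X', #{y ∈ X' | y ≠ x ∧ ∃ l ∈ Ls, r ≤ #(X' ∩ l) ∧ x ∈ l ∧ y ∈ l} ≤ r ^ (5 * r ^ 2)) ∧
      ∀ S, S ⊆ X' → ∃ l ∈ Ls, r ≤ #(X' ∩ l) ∧ (X' ∩ l ⊆ S ∨ Disjoint (X' ∩ l) S) := by
  classical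
  have hr0 : 0 < r := by omega
  have hrR : (0 : ℝ) < r := by exact_mod_cast hr0
  have hrR1 : (1000 : ℝ) ≤ r := by exact_mod_cast hr
  set k0 := r ^ (q * r + 2) with hk0
  have hk0pos : 0 < k0 := by positivity
  set z : ℝ := 1 / k0 with hz
  have hz0 : 0 < z := by rw [hz]; positivity
  set μ := r ^ (E + 3 * r + q) with hμ
  have hnμ : Fintype.card V = μ * k0 := by
    rw [hn, hμ, hk0, ← pow_add]; congr 1; rw [hw]; ring
  have hμbig : 20000 ≤ μ := by
    calc 20000 ≤ 1000 ^ 2 := by norm_num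
      _ ≤ r ^ 2 := by gcongr
      _ ≤ μ := Nat.pow_le_pow_right hr0 (by omega)
  have hμR : (20000 : ℝ) ≤ μ := by exact_mod_cast hμbig
  have hμpos : (0 : ℝ) < μ := by linarith
  have hzn : z * Fintype.card V = μ := by
    rw [hz, hnμ]; push_cast; field_simp
  have hLs : #Ls * r ^ 2 = Fintype.card V * sd := by
    have := incidence_count Ls sd hdeg univ
    rw [card_univ, sum_congr rfl (fun l hl => by rw [univ_inter, hLN l hl]), sum_const,
      smul_eq_mul] at this
    exact this
  have hLsR : (#Ls : ℝ) * r ^ 2 = Fintype.card V * sd := by exact_mod_cast hLs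
  have hzN : z * r ^ 2 = 1 / r ^ (q * r) := by
    rw [hz, hk0]; push_cast; rw [pow_add]; field_simp
  -- collinear sets
  have hcoll : ∀ k : ℕ, ∑ A ∈ (univ : Finset (Finset V)) with (#A = k + 1 ∧ ∃ l ∈ Ls, A ⊆ l),
      z ^ #A ≤ μ * sd / (r ^ (q * r)) ^ k := by
    intro k
    have e1 : ∑ A ∈ (univ : Finset (Finset V)) with (#A = k + 1 ∧ ∃ l ∈ Ls, A ⊆ l), z ^ #A =
        #{A ∈ (univ : Finset (Finset V)) | #A = k + 1 ∧ ∃ l ∈ Ls, A ⊆ l} * z ^ (k + 1) := by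
      rw [← nsmul_eq_mul, ← sum_const]
      apply sum_congr rfl
      intro A hA
      rw [(mem_filter.1 hA).2.1]
    rw [e1]
    have e2 : (#{A ∈ (univ : Finset (Finset V)) | #A = k + 1 ∧ ∃ l ∈ Ls, A ⊆ l} : ℝ) ≤
        #Ls * (r ^ 2) ^ (k + 1) := by
      exact_mod_cast count_coll Ls (r ^ 2) (k + 1) hLN
    calc _ ≤ #Ls * ((r : ℝ) ^ 2) ^ (k + 1) * z ^ (k + 1) := by gcongr
      _ = (#Ls * (r : ℝ) ^ 2) * z * (z * r ^ 2) ^ k := by ring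
      _ = (z * Fintype.card V) * sd * (z * r ^ 2) ^ k := by rw [hLsR]; ring
      _ = _ := by rw [hzn, hzN]; rw [div_pow, one_pow]; ring
  have hrq : (1000 : ℝ) * r ≤ r ^ q := by
    calc (1000 : ℝ) * r ≤ r ^ 2 := by nlinarith
      _ ≤ r ^ q := pow_le_pow_right₀ (by linarith) (by omega)
  have hrq0 : (0 : ℝ) < r ^ q := by positivity
  obtain ⟨r', hr'⟩ : ∃ r', r = r' + 1 := ⟨r - 1, by omega⟩
  have hsdR : (sd : ℝ) = (r : ℝ) ^ (q * (r + 1) * (r - 1)) := by rw [hsd, hw]; push_cast; rfl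
  have s1 : (sd : ℝ) * r ^ q = (r ^ (q * r)) ^ r := by
    rw [hsdR, ← pow_add, ← pow_mul]
    congr 1
    rw [hr', Nat.add_sub_cancel]; ring
  have s2 : (sd : ℝ) * r ^ q = (r ^ (q * r)) * (r ^ (q * r)) ^ (r - 1) := by
    rw [s1, ← pow_succ', Nat.sub_add_cancel hr0]
  obtain ⟨X, hX1, hX2, hX3, hX4⟩ := fm_exists z hz0.le (μ / 4 + 1)
    {A ∈ (univ : Finset (Finset V)) | #A = r + 1 ∧ ∃ l ∈ Ls, A ⊆ l}
    {A ∈ (univ : Finset (Finset V)) | #A = r ∧ ∃ l ∈ Ls, A ⊆ l}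
    {A ∈ (univ : Finset (Finset V)) | LineFree Ls r A ∧ μ ≤ 10 * #A}
    (40 / μ) (40 * r / (r ^ (q * r) * μ)) (by positivity) (by positivity)
    (small_numeric _ μ k0 z hk0pos hz hnμ hμbig)
    (by
      calc _ ≤ 40 / (μ : ℝ) * (μ * sd / (r ^ (q * r)) ^ r) := by
            gcongr; exact hcoll r
        _ = 40 / r ^ q := by
          rw [← s1]
          have : (0 : ℝ) < sd := by rw [hsdR]; positivity
          field_simp
        _ ≤ 1 / 5 := by
          rw [div_le_div_iff₀ hrq0 (by norm_num)]
          nlinarith)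
    (by
      have h5 := hcoll (r - 1)
      rw [Nat.sub_add_cancel hr0] at h5
      calc _ ≤ 40 * r / (r ^ (q * r) * μ) * (μ * sd / ((r : ℝ) ^ (q * r)) ^ (r - 1)) := by
            gcongr
        _ = 40 * r * sd / (r ^ (q * r) * (r ^ (q * r)) ^ (r - 1)) := by
          field_simp
        _ = 40 * r / r ^ q := by
          rw [← s2]
          have : (0 : ℝ) < sd := by rw [hsdR]; positivity
          field_simp
        _ ≤ 1 / 5 := by
          rw [div_le_div_iff₀ hrq0 (by norm_num)]
          nlinarith)
    (by
      have hb := PF_bound Ls r w E sd (3 * z) ((r : ℝ) ^ (3 * r + 1)) (by omega)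
        (by rw [hw, hq]; nlinarith) (by positivity) (one_le_pow₀ (by linarith)) hLN hlin hdeg hsd hn
      have hb2 := hb.trans (PF_numeric r w E q k0 (Fintype.card V) μ z hr hq hk0pos hz hμ hnμ hn)
      calc _ ≤ ∑ A ∈ (univ : Finset (Finset V)) with (LineFree Ls r A ∧ μ ≤ 10 * #A),
            Real.exp (-(μ / 10)) * (3 * z) ^ #A := by
            apply sum_le_sum
            intro A hA
            have hA' := (mem_filter.1 hA).2.2
            have hA'' : (μ : ℝ) ≤ 10 * #A := by exact_mod_cast hA'
            have e1 : Real.exp (#A) ≤ 3 ^ #A := by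
              have := Real.exp_one_lt_d9
              rw [← mul_one ((#A : ℕ) : ℝ), Real.exp_nat_mul]
              gcongr
              linarith
            have e2 : Real.exp (μ / 10) ≤ 3 ^ #A :=
              (Real.exp_le_exp.2 (by linarith)).trans e1
            rw [mul_pow, ← mul_assoc]
            apply le_mul_of_one_le_left (by positivity)
            rw [Real.exp_neg, inv_mul_eq_div, one_le_div (Real.exp_pos _)]
            exact e2
        _ ≤ Real.exp (-(μ / 10)) * PF (3 * z) univ (LineFree Ls r) := by
            rw [← mul_sum]
            gcongr
            unfold PF
            apply sum_le_sum_of_subset_of_nonneg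
            · intro A hA
              have := (mem_filter.1 hA).2.1
              simp [this]
            · intros; positivity
        _ ≤ Real.exp (-(μ / 10)) * Real.exp (13 * μ / r) := by gcongr
        _ = Real.exp (-(μ / 10) + 13 * μ / r) := by rw [Real.exp_add]
        _ ≤ Real.exp (-4) := by
            apply Real.exp_le_exp.2
            have : 13 * (μ : ℝ) / r ≤ μ / 20 := by
              rw [div_le_div_iff₀ hrR (by norm_num)]
              nlinarith
            linarith
        _ ≤ 1 / 5 := by
            rw [Real.exp_neg, inv_eq_one_div]
            apply one_div_le_one_div_of_le (by norm_num)
            linarith [Real.add_one_le_exp (4 : ℝ)])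
  obtain ⟨X', hXa, hXb⟩ := cleanup Ls r μ (r ^ (q * r)) X (by omega)
    (by
      rw [div_mul_eq_mul_div, div_le_one hμpos] at hX2
      exact_mod_cast hX2)
    (by
      rw [div_mul_eq_mul_div, div_le_one (by positivity)] at hX3
      exact_mod_cast hX3) (by positivity)
    (by
      intro I hI hμI hfree
      exact hX4 I (mem_filter.2 ⟨mem_univ _, hfree, hμI⟩) hI)
  refine ⟨X', fun x hx => (hXa x hx).trans ?_, hXb⟩
  rw [← pow_succ]
  apply Nat.pow_le_pow_right hr0
  rw [hq]
  nlinarith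

def gridLine {s N : ℕ} (i : Fin s) (x : Fin s → Fin N) : Finset (Fin s → Fin N) :=
  {y | ∀ j, j ≠ i → y j = x j}

theorem mem_gridLine {s N : ℕ} (i : Fin s) (x y : Fin s → Fin N) :
    y ∈ gridLine i x ↔ ∀ j, j ≠ i → y j = x j := by simp [gridLine]

theorem gridLine_eq {s N : ℕ} {i : Fin s} {x y : Fin s → Fin N} (h : y ∈ gridLine i x) :
    gridLine i x = gridLine i y := by
  ext u
  rw [mem_gridLine] at *
  rw [mem_gridLine]
  exact ⟨fun h' j hj => (h' j hj).trans (h j hj).symm, fun h' j hj => (h' j hj).trans (h j hj)⟩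

theorem gridLine_eq_image {s N : ℕ} (i : Fin s) (x : Fin s → Fin N) :
    gridLine i x = univ.image (fun t => Function.update x i t) := by
  ext y
  simp only [mem_gridLine, mem_image, mem_univ, true_and]
  constructor
  · intro h
    refine ⟨y i, ?_⟩
    ext j
    by_cases hj : j = i
    · subst hj; simp
    · simp [hj, h j hj]
  · rintro ⟨t, rfl⟩ j hj
    simp [hj]

theorem card_gridLine {s N : ℕ} (i : Fin s) (x : Fin s → Fin N) : #(gridLine i x) = N := by
  rw [gridLine_eq_image, card_image_of_injective _ (Function.update_injective x i)]
  simp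

def gridLines (s N : ℕ) : Finset (Finset (Fin s → Fin N)) :=
  univ.image (fun p : Fin s × (Fin s → Fin N) => gridLine p.1 p.2)

theorem mem_gridLines {s N : ℕ} (l : Finset (Fin s → Fin N)) :
    l ∈ gridLines s N ↔ ∃ i x, gridLine i x = l := by
  simp [gridLines]

theorem gridLines_lin {s N : ℕ} : ∀ l ∈ gridLines s N, ∀ l' ∈ gridLines s N, ∀ x y, x ≠ y →
    x ∈ l → x ∈ l' → y ∈ l → y ∈ l' → l = l' := by
  intro l hl l' hl' x y hxy hxl hxl' hyl hyl'
  obtain ⟨i, a, rfl⟩ := (mem_gridLines _).1 hl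
  obtain ⟨i', a', rfl⟩ := (mem_gridLines _).1 hl'
  rw [gridLine_eq hxl] at hyl ⊢
  rw [gridLine_eq hxl'] at hyl' ⊢
  have : i = i' := by
    by_contra hne
    apply hxy
    ext j
    rw [mem_gridLine] at hyl hyl'
    by_cases hj : j = i
    · rw [hyl' j (by rw [hj]; exact hne)]
    · rw [hyl j hj]
  rw [this]

theorem gridLines_deg {s N : ℕ} (hN : 2 ≤ N) (x : Fin s → Fin N) :
    #{l ∈ gridLines s N | x ∈ l} = s := by
  have : {l ∈ gridLines s N | x ∈ l} = univ.image (fun i => gridLine i x) := by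
    ext l
    simp only [mem_filter, mem_gridLines, mem_image, mem_univ, true_and]
    constructor
    · rintro ⟨⟨i, a, rfl⟩, hx⟩
      exact ⟨i, (gridLine_eq hx).symm⟩
    · rintro ⟨i, rfl⟩
      exact ⟨⟨i, x, rfl⟩, (mem_gridLine _ _ _).2 (fun _ _ => rfl)⟩
  rw [this, card_image_of_injective]
  · simp
  · intro i i' hii
    by_contra hne
    have : Nontrivial (Fin N) := Fin.nontrivial_iff_two_le.2 hN
    obtain ⟨t, ht⟩ := exists_ne (x i)
    have h1 : Function.update x i t ∈ gridLine i x := by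
      rw [mem_gridLine]; intro j hj; simp [hj]
    simp only at hii
    rw [hii, mem_gridLine] at h1
    have := h1 i hne
    simp at this
    exact ht this

theorem grid_exists (r : ℕ) (hr : 1000 ≤ r) : ∃ (s N : ℕ) (X' : Finset (Fin s → Fin N)),
      (∀ x ∈ X', #{y ∈ X' | y ≠ x ∧ ∃ l ∈ gridLines s N, r ≤ #(X' ∩ l) ∧ x ∈ l ∧ y ∈ l}
        ≤ r ^ (5 * r ^ 2)) ∧
      ∀ S, S ⊆ X' → ∃ l ∈ gridLines s N, r ≤ #(X' ∩ l) ∧ (X' ∩ l ⊆ S ∨ Disjoint (X' ∩ l) S) := by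
  set q := 3 * r + 4 with hq
  set w := q * (r + 1) with hw
  set sd := r ^ (w * (r - 1)) with hsd
  have hle : 3 * r + w + 2 ≤ 2 * sd := by
    have h1 : w * (r - 1) < sd := Nat.lt_pow_self (by omega)
    have h2 : w * 2 ≤ w * (r - 1) := Nat.mul_le_mul_left _ (by omega)
    have h3 : q * 1 ≤ w := Nat.mul_le_mul_left _ (by omega)
    omega
  obtain ⟨E, hE⟩ : ∃ E, 2 * sd = E + 3 * r + w + 2 := ⟨2 * sd - (3 * r + w + 2), by omega⟩
  refine ⟨sd, r ^ 2, abstract_exists (gridLines sd (r ^ 2)) r q w E sd hr hq hw ?_ gridLines_lin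
    (gridLines_deg (by nlinarith)) hsd ?_⟩
  · intro l hl
    obtain ⟨i, x, rfl⟩ := (mem_gridLines _).1 hl
    exact card_gridLine i x
  · simp only [Fintype.card_fun, Fintype.card_fin]
    rw [← pow_mul, hE]


/-- A rationally independent family of reals of any finite length. -/
theorem exists_indep (s : ℕ) : ∃ c : Fin s → ℝ, LinearIndependent ℚ c := by
  have h : (s : Cardinal) ≤ Module.rank ℚ ℝ := by
    rw [Real.rank_rat_real]
    exact (Cardinal.natCast_lt_aleph0.trans Cardinal.aleph0_lt_continuum).le
  obtain ⟨t, ht, hli⟩ := (le_rank_iff_exists_linearIndependent (K := ℚ) (V := ℝ)).1 h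
  have hc : Cardinal.mk t = Cardinal.mk (Fin s) := by rw [ht, Cardinal.mk_fin]
  obtain ⟨e⟩ := Cardinal.eq.1 hc
  exact ⟨fun i => (e.symm i : ℝ), hli.comp _ e.symm.injective⟩

theorem indep_zero {s : ℕ} {c : Fin s → ℝ} (hc : LinearIndependent ℚ c) (d : Fin s → ℤ)
    (h : ∑ j, c j * (d j : ℝ) = 0) : ∀ j, d j = 0 := by
  intro j
  have := Fintype.linearIndependent_iff.1 hc (fun j => (d j : ℚ)) (by
    rw [← h]
    refine Finset.sum_congr rfl fun j _ => ?_
    rw [Rat.smul_def]; push_cast; ring) j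
  exact_mod_cast this

/-- The dual line of a grid point. -/
def dualLine {s N : ℕ} (c : Fin s → ℝ) (x : Fin s → Fin N) : Set (Fin 2 → ℝ) :=
  {p | ∃ t : ℝ, p = ![0, ∑ j, c j * ((j : ℕ) : ℝ) * ((x j : ℕ) : ℝ)] +
    t • ![1, ∑ j, c j * ((x j : ℕ) : ℝ)]}

theorem dualLine_isLine {s N : ℕ} (c : Fin s → ℝ) (x : Fin s → Fin N) :
    IsLine (dualLine c x) := by
  refine ⟨_, _, ?_, rfl⟩
  intro h
  have := congrFun h 0
  simp at this

theorem mem_dualLine {s N : ℕ} (c : Fin s → ℝ) (x : Fin s → Fin N) (p : Fin 2 → ℝ) :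
    p ∈ dualLine c x ↔ p 1 = ∑ j, c j * ((j : ℕ) : ℝ) * ((x j : ℕ) : ℝ) +
      p 0 * ∑ j, c j * ((x j : ℕ) : ℝ) := by
  constructor
  · rintro ⟨t, rfl⟩
    simp
  · intro h
    refine ⟨p 0, ?_⟩
    ext i
    fin_cases i
    · simp
    · simpa using h

theorem dualLine_inj {s N : ℕ} {c : Fin s → ℝ} (hc : LinearIndependent ℚ c) :
    Function.Injective (dualLine (N := N) c) := by
  intro x y h
  have key : ∀ t : ℝ, ∑ j, c j * ((j : ℕ) : ℝ) * ((x j : ℕ) : ℝ) +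
      t * ∑ j, c j * ((x j : ℕ) : ℝ) = ∑ j, c j * ((j : ℕ) : ℝ) * ((y j : ℕ) : ℝ) +
      t * ∑ j, c j * ((y j : ℕ) : ℝ) := by
    intro t
    have h1 : ![t, ∑ j, c j * ((j : ℕ) : ℝ) * ((x j : ℕ) : ℝ) +
      t * ∑ j, c j * ((x j : ℕ) : ℝ)] ∈ dualLine c x := by
      rw [mem_dualLine]; simp
    rw [h, mem_dualLine] at h1
    simpa using h1
  have k0 := key 0
  have k1 := key 1
  have hz := indep_zero hc (fun j => ((x j : ℕ) : ℤ) - ((y j : ℕ) : ℤ)) (by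
    push_cast
    simp only [mul_sub, Finset.sum_sub_distrib]
    linarith)
  ext j
  have := hz j
  omega

theorem dual_point {s N : ℕ} {c : Fin s → ℝ} (hc : LinearIndependent ℚ c)
    (l : Finset (Fin s → Fin N)) (hl : l ∈ gridLines s N) :
    ∃ p : Fin 2 → ℝ, ∀ x, p ∈ dualLine c x ↔ x ∈ l := by
  obtain ⟨i, x0, rfl⟩ := (mem_gridLines l).1 hl
  refine ⟨![-((i : ℕ) : ℝ), ∑ j, c j * (((j : ℕ) : ℝ) - ((i : ℕ) : ℝ)) * ((x0 j : ℕ) : ℝ)], ?_⟩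
  intro x
  rw [mem_dualLine, mem_gridLine]
  have e : ∑ j, c j * ((j : ℕ) : ℝ) * ((x j : ℕ) : ℝ) +
      (-((i : ℕ) : ℝ)) * ∑ j, c j * ((x j : ℕ) : ℝ) =
      ∑ j, c j * (((j : ℕ) : ℝ) - ((i : ℕ) : ℝ)) * ((x j : ℕ) : ℝ) := by
    rw [Finset.mul_sum, ← Finset.sum_add_distrib]
    refine Finset.sum_congr rfl fun j _ => ?_
    ring
  simp only [Matrix.cons_val_zero, Matrix.cons_val_one]
  rw [e]
  constructor
  · intro h j hj
    have hz := indep_zero hc (fun j => (((j : ℕ) : ℤ) - ((i : ℕ) : ℤ)) *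
      (((x0 j : ℕ) : ℤ) - ((x j : ℕ) : ℤ))) (by
        push_cast
        rw [← sub_eq_zero, ← Finset.sum_sub_distrib] at h
        rw [← h]
        refine Finset.sum_congr rfl fun j _ => ?_
        ring) j
    have hne : ((j : ℕ) : ℤ) - ((i : ℕ) : ℤ) ≠ 0 := by
      intro h0
      apply hj
      ext
      omega
    have := (mul_eq_zero.1 hz).resolve_left hne
    ext
    omega
  · intro h
    refine Finset.sum_congr rfl fun j _ => ?_
    by_cases hj : j = i
    · subst hj; simp
    · rw [h j hj]

end

end


/-- Theorem 5 of the paper: for every sufficiently large r, with T = r^(5r²), there are a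
finite point set P and a finite line family L in the plane such that every point of P is
on at least r lines of L, every line of L meets at most T other lines of L in points of P,
and L cannot be split into two subfamilies each covering P. -/
theorem nondecomposable_covering_lines :
    ∃ r₀ : ℕ, ∀ r : ℕ, r₀ ≤ r →
      ∃ (P : Set (Fin 2 → ℝ)) (L : Set (Set (Fin 2 → ℝ))),
        P.Finite ∧ L.Finite ∧ (∀ ℓ ∈ L, IsLine ℓ) ∧
        (∀ p ∈ P, r ≤ {ℓ ∈ L | p ∈ ℓ}.ncard) ∧
        (∀ ℓ ∈ L, {ℓ' ∈ L | ℓ' ≠ ℓ ∧ ∃ p ∈ P, p ∈ ℓ ∧ p ∈ ℓ'}.ncard ≤ r ^ (5 * r ^ 2)) ∧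
        (∀ L₁ L₂ : Set (Set (Fin 2 → ℝ)), L₁ ∪ L₂ = L → Disjoint L₁ L₂ →
          ∃ p ∈ P, (∀ ℓ ∈ L₁, p ∉ ℓ) ∨ (∀ ℓ ∈ L₂, p ∉ ℓ)) := by
  classical
  refine ⟨1000, fun r hr => ?_⟩
  obtain ⟨s, N, X, hdeg, hcol⟩ := grid_exists r hr
  obtain ⟨c, hc⟩ := exists_indep s
  have hinj := dualLine_inj (N := N) hc
  have hpt : ∀ l : Finset (Fin s → Fin N), ∃ p : Fin 2 → ℝ, l ∈ gridLines s N →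
      ∀ x, p ∈ dualLine c x ↔ x ∈ l := by
    intro l
    by_cases hl : l ∈ gridLines s N
    · obtain ⟨p, hp⟩ := dual_point hc l hl
      exact ⟨p, fun _ => hp⟩
    · exact ⟨0, fun h => absurd h hl⟩
  choose pt hpt using hpt
  refine ⟨pt '' {l | l ∈ gridLines s N ∧ r ≤ (X ∩ l).card}, dualLine c '' (X : Set (Fin s → Fin N)),
    ?_, ?_, ?_, ?_, ?_, ?_⟩
  · exact (Set.toFinite _).image _
  · exact (Set.toFinite _).image _
  · rintro _ ⟨x, -, rfl⟩
    exact dualLine_isLine c x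
  · rintro _ ⟨l, ⟨hl, hlr⟩, rfl⟩
    have : {ℓ ∈ dualLine c '' (X : Set (Fin s → Fin N)) | pt l ∈ ℓ} =
        dualLine c '' ((X ∩ l : Finset (Fin s → Fin N)) : Set (Fin s → Fin N)) := by
      ext ℓ
      constructor
      · rintro ⟨⟨x, hx, rfl⟩, h⟩
        exact ⟨x, by simpa using ⟨hx, (hpt l hl x).1 h⟩, rfl⟩
      · rintro ⟨x, hx, rfl⟩
        have hx' := Finset.mem_inter.1 (Finset.mem_coe.1 hx)
        exact ⟨⟨x, Finset.mem_coe.2 hx'.1, rfl⟩, (hpt l hl x).2 hx'.2⟩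
    rw [this, Set.ncard_image_of_injective _ hinj, Set.ncard_coe_finset]
    exact hlr
  · rintro _ ⟨x, hx, rfl⟩
    refine le_trans ?_ (hdeg x hx)
    rw [← Set.ncard_coe_finset, ← Set.ncard_image_of_injective _ hinj]
    refine Set.ncard_le_ncard ?_ ((Set.toFinite _).image _)
    rintro _ ⟨⟨y, hy, rfl⟩, hne, _, ⟨l, ⟨hl, hlr⟩, rfl⟩, h1, h2⟩
    refine ⟨y, ?_, rfl⟩
    rw [Finset.mem_coe, Finset.mem_filter]
    refine ⟨hy, fun h => hne (by rw [h]), l, hl, ?_, (hpt l hl x).1 h1, (hpt l hl y).1 h2⟩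
    convert hlr
  · intro L₁ L₂ hun hdis
    obtain ⟨l, hl, hlr, hS⟩ := hcol (X.filter fun x => dualLine c x ∈ L₁) (Finset.filter_subset _ _)
    refine ⟨pt l, ⟨l, ⟨hl, by convert hlr⟩, rfl⟩, ?_⟩
    rcases hS with hS | hS
    · right
      intro ℓ hℓ hp
      have hL : ℓ ∈ dualLine c '' (X : Set (Fin s → Fin N)) := hun ▸ Or.inr hℓ
      obtain ⟨x, hx, rfl⟩ := hL
      have hm : x ∈ X ∩ l := Finset.mem_inter.2 ⟨hx, (hpt l hl x).1 hp⟩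
      have := (Finset.mem_filter.1 (hS (by convert hm))).2
      exact Set.disjoint_left.1 hdis this hℓ
    · left
      intro ℓ hℓ hp
      have hL : ℓ ∈ dualLine c '' (X : Set (Fin s → Fin N)) := hun ▸ Or.inl hℓ
      obtain ⟨x, hx, rfl⟩ := hL
      have hm : x ∈ X ∩ l := Finset.mem_inter.2 ⟨hx, (hpt l hl x).1 hp⟩
      exact Finset.disjoint_left.1 hS (by convert hm) (Finset.mem_filter.2 ⟨hx, hℓ⟩)
end
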